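/- arXiv:1207.5869 — 4 statements merged into one kernel-verified Lean document; each statement's English description precedes it below -/
import Mathlib

section
/- Let R be a commutative Noetherian local ring and M a finitely generated R-module. Then M is a test module (i.e., every finitely generated R-module N with Tor_i^R(M,N)=0 for all sufficiently large i has finite projective dimension) if and only if M/xM is a test module, for any element x of the maximal ideal that is a non zero-divisor on M. -/
open CategoryTheory IsLocalRing

noncomputable def TorM (R : Type) [CommRing R] (i : ℕ) (M N : ModuleCat R) : ModuleCat R :=
  ((Tor (ModuleCat R) i).obj M).obj N

noncomputable def ExtM (R : Type) [CommRing R] (i : ℕ) (M N : ModuleCat R) : ModuleCat R :=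
  ((Ext R (ModuleCat R) i).obj (Opposite.op M)).obj N

/-- Eventual vanishing of `Tor_i^R(M, N)` for `i ≫ 0`. -/
def TorEventuallyZero (R : Type) [CommRing R] (M N : ModuleCat R) : Prop :=
  ∃ n : ℕ, ∀ i : ℕ, n ≤ i → Subsingleton (TorM R i M N)

/-- `N` has projective dimension at most `n`. -/
def ProjDimLE (R : Type) [CommRing R] (N : ModuleCat R) (n : ℕ) : Prop :=
  ∀ i : ℕ, n < i → ∀ L : ModuleCat R, Subsingleton (ExtM R i N L)

/-- `N` has finite projective dimension. -/
def FinProjDim (R : Type) [CommRing R] (N : ModuleCat R) : Prop :=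
  ∃ n : ℕ, ProjDimLE R N n

/-- `N` has finite injective dimension. -/
def FinInjDim (R : Type) [CommRing R] (N : ModuleCat R) : Prop :=
  ∃ n : ℕ, ∀ i : ℕ, n < i → ∀ L : ModuleCat R, Subsingleton (ExtM R i L N)

/-- `M` is a test module: every finitely generated module `N` with
`Tor_i^R(M,N) = 0` for `i ≫ 0` has finite projective dimension. -/
def IsTestModule (R : Type) [CommRing R] (M : ModuleCat R) : Prop :=
  ∀ N : ModuleCat R, Module.Finite R N → TorEventuallyZero R M N → FinProjDim R N

open CategoryTheory.Limits CategoryTheory.MonoidalCategory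

/-- Every module has a projective cover by a module which is finite if the module is. -/
lemma exists_fcover (R : Type) [CommRing R] (X : ModuleCat.{0} R) :
    ∃ (P : ModuleCat.{0} R) (p : P ⟶ X), Projective P ∧ Epi p ∧
      (Module.Finite R X → Module.Finite R P) := by
  by_cases h : Module.Finite R X
  · obtain ⟨n, f, hf⟩ := Module.Finite.exists_fin' R X
    refine ⟨ModuleCat.of R (Fin n → R), ModuleCat.ofHom f, ?_, ?_, fun _ => ?_⟩
    · exact ModuleCat.projective_of_free (Pi.basisFun R (Fin n))
    · rw [ModuleCat.epi_iff_surjective]; exact hf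
    · change Module.Finite R (Fin n → R); infer_instance
  · exact ⟨Projective.over X, Projective.π X, inferInstance, inferInstance, fun h' => absurd h' h⟩

section

variable {R : Type} [CommRing R]

noncomputable def fover (X : ModuleCat.{0} R) : ModuleCat.{0} R := (exists_fcover R X).choose

noncomputable def fpi (X : ModuleCat.{0} R) : fover X ⟶ X :=
  (exists_fcover R X).choose_spec.choose

instance (X : ModuleCat.{0} R) : Projective (fover X) :=
  (exists_fcover R X).choose_spec.choose_spec.1

instance (X : ModuleCat.{0} R) : Epi (fpi X) :=
  (exists_fcover R X).choose_spec.choose_spec.2.1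

lemma fover_finite (X : ModuleCat.{0} R) (h : Module.Finite R X) : Module.Finite R (fover X) :=
  (exists_fcover R X).choose_spec.choose_spec.2.2 h

noncomputable def fd {X Y : ModuleCat.{0} R} (f : X ⟶ Y) : fover (kernel f) ⟶ X :=
  fpi (kernel f) ≫ kernel.ι f

lemma fd_comp {X Y : ModuleCat.{0} R} (f : X ⟶ Y) : fd f ≫ f = 0 := by
  simp [fd]

theorem exact_fd_f {X Y : ModuleCat.{0} R} (f : X ⟶ Y) :
    (ShortComplex.mk (fd f) f (fd_comp f)).Exact := by
  let α : ShortComplex.mk (fd f) f (fd_comp f) ⟶ ShortComplex.mk (kernel.ι f) f (by simp) :=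
    { τ₁ := fpi _
      τ₂ := 𝟙 _
      τ₃ := 𝟙 _ 
      comm₁₂ := by simp [fd] }
  have : Epi α.τ₁ := inferInstanceAs (Epi (fpi _))
  have : IsIso α.τ₂ := inferInstanceAs (IsIso (𝟙 _))
  have : Mono α.τ₃ := inferInstanceAs (Mono (𝟙 _))
  rw [ShortComplex.exact_iff_of_epi_of_isIso_of_mono α]
  apply ShortComplex.exact_of_f_is_kernel
  apply kernelIsKernel

noncomputable def fcx (Z : ModuleCat.{0} R) : ChainComplex (ModuleCat.{0} R) ℕ :=
  ChainComplex.mk' (fover Z) (fover (kernel (fpi Z))) (fd (fpi Z))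
    (fun f => ⟨fover (kernel f), fd f, fd_comp f⟩)

noncomputable def fcxIso (Z : ModuleCat.{0} R) (n : ℕ) :
    (fcx Z).X (n + 2) ≅ fover (kernel ((fcx Z).d (n + 1) n)) :=
  ChainComplex.mk'XIso (fover Z) (fover (kernel (fpi Z))) (fd (fpi Z))
    (fun f => ⟨fover (kernel f), fd f, fd_comp f⟩) n

lemma fcx_d (Z : ModuleCat.{0} R) (n : ℕ) :
    (fcx Z).d (n + 2) (n + 1) = (fcxIso Z n).hom ≫ fd ((fcx Z).d (n + 1) n) :=
  ChainComplex.mk'_d (fover Z) (fover (kernel (fpi Z))) (fd (fpi Z))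
    (fun f => ⟨fover (kernel f), fd f, fd_comp f⟩) n

lemma fcx_d_1_0 (Z : ModuleCat.{0} R) : (fcx Z).d 1 0 = fd (fpi Z) :=
  ChainComplex.mk'_d_1_0 (fover Z) (fover (kernel (fpi Z))) (fd (fpi Z))
    (fun f => ⟨fover (kernel f), fd f, fd_comp f⟩)

lemma fcx_exactAt_succ (Z : ModuleCat.{0} R) (n : ℕ) : (fcx Z).ExactAt (n + 1) := by
  rw [HomologicalComplex.exactAt_iff' _ (n + 1 + 1) (n + 1) n (by simp) (by simp)]
  refine (ShortComplex.exact_iff_of_iso ?_).2 (exact_fd_f ((fcx Z).d (n + 1) n))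
  exact ShortComplex.isoMk (fcxIso Z n) (Iso.refl _) (Iso.refl _)
    ((fcx_d Z n).symm.trans (Category.comp_id _).symm)
    ((Category.id_comp _).trans (Category.comp_id _).symm)

lemma fcx_projective (Z : ModuleCat.{0} R) (n : ℕ) : Projective ((fcx Z).X n) := by
  obtain _ | _ | n := n
  · exact inferInstanceAs (Projective (fover Z))
  · exact inferInstanceAs (Projective (fover (kernel (fpi Z))))
  · exact Projective.of_iso (fcxIso Z n).symm inferInstance

lemma kernel_finite [IsNoetherianRing R] {X Y : ModuleCat.{0} R} (f : X ⟶ Y)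
    (h : Module.Finite R X) : Module.Finite R (kernel f : ModuleCat.{0} R) :=
  Module.Finite.of_injective (kernel.ι f).hom
    ((ModuleCat.mono_iff_injective _).1 inferInstance)

lemma fcx_finite [IsNoetherianRing R] (Z : ModuleCat.{0} R) (h : Module.Finite R Z) (n : ℕ) :
    Module.Finite R ((fcx Z).X n) := by
  have h0 : Module.Finite R (fover Z) := fover_finite Z h
  induction n using Nat.strong_induction_on with
  | _ n ih =>
    obtain _ | _ | n := n
    · exact h0
    · exact fover_finite _ (kernel_finite (fpi Z) h0)
    · have := fover_finite _ (kernel_finite ((fcx Z).d (n + 1) n) (ih (n + 1) (by omega)))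
      exact Module.Finite.equiv (fcxIso Z n).symm.toLinearEquiv

noncomputable def fres (Z : ModuleCat.{0} R) : ProjectiveResolution Z where
  complex := fcx Z
  projective := fcx_projective Z
  π := (ChainComplex.toSingle₀Equiv _ _).symm ⟨fpi Z, by rw [fcx_d_1_0]; exact fd_comp _⟩
  quasiIso := ⟨fun n => by
    cases n
    · rw [ChainComplex.quasiIsoAt₀_iff, ShortComplex.quasiIso_iff_of_zeros']
      · refine (ShortComplex.exact_and_epi_g_iff_of_iso ?_).2
          ⟨exact_fd_f (fpi Z), inferInstanceAs (Epi (fpi Z))⟩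
        refine ShortComplex.isoMk (Iso.refl _) (Iso.refl _) (Iso.refl _) ?_ ?_
        · exact (Category.id_comp _).trans ((fcx_d_1_0 Z).symm.trans (Category.comp_id _).symm)
        · refine (Category.id_comp _).trans (Eq.trans ?_ (Category.comp_id _).symm)
          exact (ChainComplex.toSingle₀Equiv_symm_apply_f_zero (C := fcx Z) (fpi Z)
            (by rw [fcx_d_1_0]; exact fd_comp _)).symm
      all_goals rfl
    · rw [quasiIsoAt_iff_exactAt']
      · apply fcx_exactAt_succ
      · apply ChainComplex.exactAt_succ_single_obj⟩

/-- The tensor product complex. -/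
noncomputable abbrev tcx (M : ModuleCat.{0} R) (N : ModuleCat.{0} R) :
    ChainComplex (ModuleCat.{0} R) ℕ :=
  (((tensoringLeft (ModuleCat.{0} R)).obj M).mapHomologicalComplex _).obj (fcx N)

noncomputable def torIso (M N : ModuleCat.{0} R) (i : ℕ) :
    TorM R i M N ≅ (tcx M N).homology i :=
  (fres N).isoLeftDerivedObj ((tensoringLeft (ModuleCat.{0} R)).obj M) i

noncomputable abbrev tmap {M M' : ModuleCat.{0} R} (f : M ⟶ M') (N : ModuleCat.{0} R) :
    tcx M N ⟶ tcx M' N :=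
  (NatTrans.mapHomologicalComplex ((tensoringLeft (ModuleCat.{0} R)).map f) _).app (fcx N)

lemma tmap_f {M M' : ModuleCat.{0} R} (f : M ⟶ M') (N : ModuleCat.{0} R) (i : ℕ) :
    (tmap f N).f i = f ▷ ((fcx N).X i) := rfl

lemma tmap_smul (M : ModuleCat.{0} R) (x : R) (N : ModuleCat.{0} R) :
    tmap (x • 𝟙 M) N = x • 𝟙 (tcx M N) := by
  ext1 i
  rw [tmap_f, HomologicalComplex.smul_f_apply, MonoidalLinear.smul_whiskerRight, id_whiskerRight]
  rfl

lemma homology_tmap_smul (M : ModuleCat.{0} R) (x : R) (N : ModuleCat.{0} R) (i : ℕ) :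
    HomologicalComplex.homologyMap (tmap (x • 𝟙 M) N) i = x • 𝟙 ((tcx M N).homology i) := by
  rw [tmap_smul]
  refine (ShortComplex.homologyMap_smul (𝟙 ((tcx M N).sc i)) x).trans ?_
  rw [ShortComplex.homologyMap_id]
  rfl

lemma tcx_homology_finite [IsNoetherianRing R] (M N : ModuleCat.{0} R)
    (hM : Module.Finite R M) (hN : Module.Finite R N) (i : ℕ) :
    Module.Finite R ((tcx M N).homology i) := by
  have h1 : Module.Finite R ((tcx M N).X i) := by
    have := fcx_finite N hN i
    exact inferInstanceAs (Module.Finite R (TensorProduct R M ((fcx N).X i)))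
  have h2 : Module.Finite R ((tcx M N).cycles i) :=
    Module.Finite.of_injective ((tcx M N).iCycles i).hom
      ((ModuleCat.mono_iff_injective _).1 inferInstance)
  exact Module.Finite.of_surjective ((tcx M N).homologyπ i).hom
      ((ModuleCat.epi_iff_surjective _).1 inferInstance)

/-- The short complex of complexes. -/
noncomputable def tsc (S : ShortComplex (ModuleCat.{0} R)) (N : ModuleCat.{0} R) :
    ShortComplex (ChainComplex (ModuleCat.{0} R) ℕ) :=
  ShortComplex.mk (tmap S.f N) (tmap S.g N) (by
    ext1 i
    change S.f ▷ ((fcx N).X i) ≫ S.g ▷ ((fcx N).X i) = 0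
    rw [← comp_whiskerRight, S.zero]
    exact MonoidalPreadditive.zero_whiskerRight)

lemma tsc_shortExact (S : ShortComplex (ModuleCat.{0} R)) (hS : S.ShortExact)
    (N : ModuleCat.{0} R) : (tsc S N).ShortExact := by
  apply HomologicalComplex.shortExact_of_degreewise_shortExact
  intro i
  have hp := fcx_projective N i
  have : Module.Projective R ((fcx N).X i) := (IsProjective.iff_projective _).2 hp
  have : Module.Flat R ((fcx N).X i) := inferInstance
  exact hS.map_of_exact (tensorRight ((fcx N).X i))

lemma tor_iff [IsNoetherianRing R] [IsLocalRing R] (M N Q : ModuleCat.{0} R)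
    (hM : Module.Finite R M) (hN : Module.Finite R N) (x : R) (hx : x ∈ maximalIdeal R)
    (q : M ⟶ Q) (h0 : (x • 𝟙 M) ≫ q = 0)
    (hS : (ShortComplex.mk (x • 𝟙 M) q h0).ShortExact) :
    TorEventuallyZero R M N ↔ TorEventuallyZero R Q N := by
  have key : ∀ (L : ModuleCat.{0} R) (i : ℕ),
      Subsingleton (TorM R i L N) ↔ IsZero ((tcx L N).homology i) := by
    intro L i
    rw [← ModuleCat.isZero_iff_subsingleton]
    exact (torIso L N i).isZero_iff
  have hT := tsc_shortExact _ hS N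
  simp only [TorEventuallyZero, key]
  constructor
  · rintro ⟨n, hn⟩
    refine ⟨n + 1, fun i hi => ?_⟩
    obtain ⟨j, rfl⟩ : ∃ j, i = j + 1 := ⟨i - 1, by omega⟩
    exact (hT.homology_exact₃ (j + 1) j (by simp)).isZero_X₂
      ((hn (j + 1) (by omega)).eq_of_src _ _) ((hn j (by omega)).eq_of_tgt _ _)
  · rintro ⟨n, hn⟩
    refine ⟨n, fun i hi => ?_⟩
    have hex := hT.homology_exact₂ i
    have hepi : Epi (HomologicalComplex.homologyMap (tmap (x • 𝟙 M) N) i) :=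
      hex.epi_f ((hn i hi).eq_of_tgt _ _)
    rw [homology_tmap_smul, ModuleCat.epi_iff_surjective] at hepi
    have hfin := tcx_homology_finite M N hM hN i
    rw [ModuleCat.isZero_iff_subsingleton]
    have htop : (⊤ : Submodule R ((tcx M N).homology i)) = ⊥ := by
      refine Submodule.eq_bot_of_le_smul_of_le_jacobson_bot (maximalIdeal R) ⊤ hfin.1 ?_
        (IsLocalRing.maximalIdeal_le_jacobson _)
      intro y _
      obtain ⟨z, rfl⟩ := hepi y
      exact Submodule.smul_mem_smul hx trivial
    exact (Submodule.subsingleton_iff R).1 (subsingleton_of_bot_eq_top htop.symm)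

end

/-- Over a Noetherian local ring, `M` is a test module iff `M/xM` is a test module,
for `x` in the maximal ideal that is a non zero-divisor on `M`. -/
theorem testModule_iff_quot_smul_testModule
    (R : Type) [CommRing R] [IsNoetherianRing R] [IsLocalRing R]
    (M : Type) [AddCommGroup M] [Module R M] [Module.Finite R M]
    (x : R) (hx : x ∈ maximalIdeal R)
    (hreg : ∀ m : M, x • m = 0 → m = 0) :
    IsTestModule R (ModuleCat.of R M) ↔
      IsTestModule R (ModuleCat.of R (M ⧸ (Ideal.span {x} • ⊤ : Submodule R M))) := by
  have hmem : ∀ m : M, m ∈ (Ideal.span {x} • ⊤ : Submodule R M) ↔ ∃ y, x • y = m := by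
    intro m
    rw [Submodule.ideal_span_singleton_smul, Submodule.mem_smul_pointwise_iff_exists]
    simp
  have h0 : (x • 𝟙 (ModuleCat.of R M)) ≫
      ModuleCat.ofHom (Submodule.mkQ (Ideal.span {x} • ⊤ : Submodule R M)) = 0 := by
    ext m
    exact (Submodule.Quotient.mk_eq_zero _).2 ((hmem _).2 ⟨m, rfl⟩)
  have hS : (ShortComplex.mk _ _ h0).ShortExact := by
    refine @ShortComplex.ShortExact.mk _ _ _ _ ?_ ?_ ?_
    · rw [ShortComplex.moduleCat_exact_iff]
      intro m hm
      exact (hmem _).1 ((Submodule.Quotient.mk_eq_zero _).1 hm)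
    · rw [ModuleCat.mono_iff_injective]
      exact (injective_iff_map_eq_zero (x • 𝟙 (ModuleCat.of R M)).hom).2 hreg
    · rw [ModuleCat.epi_iff_surjective]
      exact Submodule.mkQ_surjective _
  have h := fun (N : ModuleCat.{0} R) (hN : Module.Finite R N) =>
    tor_iff (ModuleCat.of R M) N _ (inferInstanceAs (Module.Finite R M)) hN x hx _ h0 hS
  constructor
  · exact fun H N hN hT => H N hN ((h N hN).2 hT)
  · exact fun H N hN hT => H N hN ((h N hN).1 hT)
end

section
/- Let R be a commutative Noetherian local ring, M a finitely generated R-module, and x an element of the maximal ideal that is a non zero-divisor on both R and M. If M/xM is a test module over the quotient ring R/xR, then M is a test module over R. -/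
open CategoryTheory IsLocalRing

open CategoryTheory.Limits

namespace TM

lemma tor_iff {R : Type} [CommRing R] (M N : ModuleCat.{0} R) (P : ProjectiveResolution N) (i : ℕ) :
    Subsingleton (TorM R (i+1) M N) ↔
      Function.Exact (LinearMap.lTensor M (P.complex.d (i+2) (i+1)).hom)
        (LinearMap.lTensor M (P.complex.d (i+1) i).hom) := by
  unfold TorM
  rw [← ModuleCat.isZero_iff_subsingleton]
  refine (P.isoLeftDerivedObj
    ((MonoidalCategory.tensoringLeft (ModuleCat R)).obj M) (i+1)).isZero_iff.trans ?_
  refine (HomologicalComplex.exactAt_iff_isZero_homology _ _).symm.trans ?_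
  rw [HomologicalComplex.exactAt_iff' _ (i+2) (i+1) i (by simp) (by simp)]
  rw [ShortComplex.ShortExact.moduleCat_exact_iff_function_exact]
  rfl

lemma ext_iff {R : Type} [CommRing R] (N L : ModuleCat.{0} R) (i : ℕ) :
    Subsingleton (ExtM R (i+1) N L) ↔ Subsingleton (Abelian.Ext N L (i+1)) := by
  let P := ProjectiveResolution.of N
  unfold ExtM
  rw [← ModuleCat.isZero_iff_subsingleton]
  rw [(P.isoExt (R := R) (i+1) L).isZero_iff]
  rw [← HomologicalComplex.exactAt_iff_isZero_homology]
  rw [HomologicalComplex.exactAt_iff' _ i (i+1) (i+2) (by simp) (by simp)]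
  rw [ShortComplex.moduleCat_exact_iff]
  constructor
  · intro h
    refine subsingleton_of_forall_eq 0 fun a => ?_
    obtain ⟨f, hf, rfl⟩ := P.extMk_surjective a (i+2) rfl
    rw [P.extMk_eq_zero_iff f (i+2) rfl hf i rfl]
    exact h f hf
  · intro h f hf
    have h0 : P.extMk (Y := L) f (i+2) rfl hf = 0 := Subsingleton.elim _ _
    rw [P.extMk_eq_zero_iff f (i+2) rfl hf i rfl] at h0
    exact h0

lemma finProjDim_iff {R : Type} [CommRing R] (N : ModuleCat.{0} R) :
    FinProjDim R N ↔ ∃ n, HasProjectiveDimensionLE N n := by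
  unfold FinProjDim ProjDimLE
  refine exists_congr fun n => ?_
  constructor
  · intro h
    refine HasProjectiveDimensionLT.mk fun i hi Y e => ?_
    obtain ⟨j, rfl⟩ : ∃ j, i = j + 1 := ⟨i - 1, by omega⟩
    have := (ext_iff N Y j).1 (h _ (by omega) Y)
    exact Subsingleton.elim _ _
  · intro h i hi L
    obtain ⟨j, rfl⟩ : ∃ j, i = j + 1 := ⟨i - 1, by omega⟩
    exact (ext_iff N L j).2 (HasProjectiveDimensionLT.subsingleton N (n+1) _ (by omega) L)

section res
variable {R : Type} [CommRing R]

lemma res_exact {N : ModuleCat.{0} R} (P : ProjectiveResolution N) (i : ℕ) :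
    Function.Exact (P.complex.d (i+2) (i+1)).hom (P.complex.d (i+1) i).hom :=
  (ShortComplex.ShortExact.moduleCat_exact_iff_function_exact _).1 (P.exact_succ i)

noncomputable def aug {N : ModuleCat.{0} R} (P : ProjectiveResolution N) : P.complex.X 0 →ₗ[R] N :=
  (P.π.f 0).hom

lemma aug_exact {N : ModuleCat.{0} R} (P : ProjectiveResolution N) :
    Function.Exact (P.complex.d 1 0).hom (aug P) :=
  (ShortComplex.ShortExact.moduleCat_exact_iff_function_exact _).1 (P.exact₀)

lemma aug_surj {N : ModuleCat.{0} R} (P : ProjectiveResolution N) :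
    Function.Surjective (aug P) :=
  (ModuleCat.epi_iff_surjective (P.π.f 0)).1 inferInstance

lemma mkRes {N : ModuleCat.{0} R} (C : ChainComplex (ModuleCat.{0} R) ℕ)
    (hp : ∀ i, Module.Projective R (C.X i)) (e : C.X 0 ⟶ N)
    (h : ∀ i, Function.Exact (C.d (i+2) (i+1)).hom (C.d (i+1) i).hom)
    (h0 : Function.Exact (C.d 1 0).hom e.hom) (hs : Function.Surjective e.hom) :
    ∃ P : ProjectiveResolution N, P.complex = C := by
  have hw : C.d 1 0 ≫ e = 0 := by
    ext a
    exact h0.apply_apply_eq_zero a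
  refine ⟨{ complex := C
            projective := fun n => (IsProjective.iff_projective _).1 (hp n)
            π := (ChainComplex.toSingle₀Equiv _ _).symm ⟨e, hw⟩
            quasiIso := ⟨fun n => ?_⟩ }, rfl⟩
  cases n with
  | zero =>
    rw [ChainComplex.quasiIsoAt₀_iff, ShortComplex.quasiIso_iff_of_zeros']
    · have : Epi e := (ModuleCat.epi_iff_surjective e).2 hs
      refine (ShortComplex.exact_and_epi_g_iff_of_iso
        (S₂ := ShortComplex.mk (C.d 1 0) e hw) ?_).2 ⟨?_, this⟩
      · exact ShortComplex.isoMk (Iso.refl _) (Iso.refl _) (Iso.refl _)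
          ((Category.id_comp _).trans (Category.comp_id _).symm)
          ((Category.id_comp _).trans (Category.comp_id _).symm)
      · exact (ShortComplex.ShortExact.moduleCat_exact_iff_function_exact _).2 h0
    · exact C.shape _ _ (by simp)
    all_goals rfl
  | succ n =>
    rw [quasiIsoAt_iff_exactAt']
    · rw [HomologicalComplex.exactAt_iff' _ (n + 1 + 1) (n + 1) n (by simp) (by simp)]
      exact (ShortComplex.ShortExact.moduleCat_exact_iff_function_exact _).2 (h n)
    · apply ChainComplex.exactAt_succ_single_obj

end res

open TensorProduct

section chase
variable {R : Type} [CommRing R] (x : R)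
  {A3 A2 A1 A0 : Type} [AddCommGroup A3] [AddCommGroup A2] [AddCommGroup A1] [AddCommGroup A0]
  [Module R A3] [Module R A2] [Module R A1] [Module R A0]
  {B3 B2 B1 : Type} [AddCommGroup B3] [AddCommGroup B2] [AddCommGroup B1]

lemma chase (d3 : A3 →ₗ[R] A2) (d2 : A2 →ₗ[R] A1) (d1 : A1 →ₗ[R] A0)
    (e3 : B3 →+ B2) (e2 : B2 →+ B1) (q3 : A3 →+ B3) (q2 : A2 →+ B2) (q1 : A1 →+ B1)
    (h32 : Function.Exact d3 d2) (h21 : Function.Exact d2 d1)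
    (hreg : ∀ a : A0, x • a = 0 → a = 0)
    (hq3 : Function.Surjective q3) (hq2 : Function.Surjective q2)
    (hk2 : ∀ a, q2 (x • a) = 0) (hk1 : ∀ a, q1 a = 0 → ∃ a', x • a' = a)
    (c3 : ∀ a, e3 (q3 a) = q2 (d3 a)) (c2 : ∀ a, e2 (q2 a) = q1 (d2 a)) :
    Function.Exact e3 e2 := by
  intro b
  constructor
  · intro hb
    obtain ⟨a, rfl⟩ := hq2 b
    rw [c2] at hb
    obtain ⟨a1, ha1⟩ := hk1 _ hb
    have h1 : d1 a1 = 0 := by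
      apply hreg
      rw [← map_smul, ha1]
      exact h21.apply_apply_eq_zero a
    obtain ⟨a2, rfl⟩ := (h21 a1).1 h1
    have h2 : d2 (a - x • a2) = 0 := by
      rw [map_sub, map_smul, ha1, sub_self]
    obtain ⟨a3, ha3⟩ := (h32 _).1 h2
    refine ⟨q3 a3, ?_⟩
    rw [c3, ha3, map_sub, hk2, sub_zero]
  · rintro ⟨b, rfl⟩
    obtain ⟨a, rfl⟩ := hq3 b
    rw [c3, c2, h32.apply_apply_eq_zero, map_zero]

end chase

section quot
variable {R : Type} [CommRing R] (x : R)

lemma rTensor_quot (M : Type) [AddCommGroup M] [Module R M] (P : Type) [AddCommGroup P] [Module R P]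
    (a : M ⊗[R] P) :
    LinearMap.rTensor P (Submodule.mkQ (Ideal.span {x} • ⊤ : Submodule R M)) a = 0 ↔
      ∃ a', x • a' = a := by
  have h1 : Function.Exact (x • (LinearMap.id : M →ₗ[R] M))
      (Submodule.mkQ (Ideal.span {x} • ⊤ : Submodule R M)) := by
    intro m
    simp [Submodule.ideal_span_singleton_smul, Submodule.mem_smul_pointwise_iff_exists]
  have h2 := rTensor_exact P h1 (Submodule.mkQ_surjective _)
  refine (h2 a).trans ?_
  simp [LinearMap.rTensor_smul]

/-- The comparison map. -/
noncomputable def qM (M : Type) [AddCommGroup M] [Module R M]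
    (P : Type) [AddCommGroup P] [Module R P] :
    M ⊗[R] P →+ (M ⧸ (Ideal.span {x} • ⊤ : Submodule R M)) ⊗[R ⧸ Ideal.span {x}]
      ((R ⧸ Ideal.span {x}) ⊗[R] P) :=
  (AlgebraTensorModule.cancelBaseChange R (R ⧸ Ideal.span {x}) (R ⧸ Ideal.span {x})
    (M ⧸ (Ideal.span {x} • ⊤ : Submodule R M)) P).symm.toLinearMap.toAddMonoidHom.comp
    (LinearMap.rTensor P (Submodule.mkQ (Ideal.span {x} • ⊤ : Submodule R M))).toAddMonoidHom

lemma qM_tmul (M : Type) [AddCommGroup M] [Module R M]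
    (P : Type) [AddCommGroup P] [Module R P] (m : M) (p : P) :
    qM x M P (m ⊗ₜ p) = (Submodule.Quotient.mk m) ⊗ₜ (1 ⊗ₜ p) := rfl

lemma qM_surj (M : Type) [AddCommGroup M] [Module R M]
    (P : Type) [AddCommGroup P] [Module R P] : Function.Surjective (qM x M P) :=
  (AlgebraTensorModule.cancelBaseChange R (R ⧸ Ideal.span {x}) (R ⧸ Ideal.span {x})
    (M ⧸ (Ideal.span {x} • ⊤ : Submodule R M)) P).symm.surjective.comp
    (LinearMap.rTensor_surjective P (Submodule.mkQ_surjective _))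

lemma qM_eq_zero (M : Type) [AddCommGroup M] [Module R M]
    (P : Type) [AddCommGroup P] [Module R P] (a : M ⊗[R] P) :
    qM x M P a = 0 ↔ ∃ a', x • a' = a := by
  rw [← rTensor_quot]
  exact (AlgebraTensorModule.cancelBaseChange R (R ⧸ Ideal.span {x}) (R ⧸ Ideal.span {x})
    (M ⧸ (Ideal.span {x} • ⊤ : Submodule R M)) P).symm.map_eq_zero_iff

lemma qM_comm (M : Type) [AddCommGroup M] [Module R M]
    (P Q : Type) [AddCommGroup P] [Module R P] [AddCommGroup Q] [Module R Q] (f : P →ₗ[R] Q)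
    (a : M ⊗[R] P) :
    LinearMap.lTensor (M ⧸ (Ideal.span {x} • ⊤ : Submodule R M))
      (f.baseChange (R ⧸ Ideal.span {x})) (qM x M P a) = qM x M Q (f.lTensor M a) := by
  induction a with
  | zero => simp
  | tmul m p => simp [qM_tmul]
  | add a b ha hb => simp only [map_add, ha, hb]

lemma q1_surj (P : Type) [AddCommGroup P] [Module R P] :
    Function.Surjective (TensorProduct.mk R (R ⧸ Ideal.span {x}) P 1) :=
  TensorProduct.mk_surjective _ _ _ Ideal.Quotient.mk_surjective

lemma q1_eq_zero (P : Type) [AddCommGroup P] [Module R P] (a : P) :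
    TensorProduct.mk R (R ⧸ Ideal.span {x}) P 1 a = 0 ↔ ∃ a', x • a' = a := by
  rw [← (QuotSMulTop.equivQuotTensor x P).symm.map_eq_zero_iff]
  have : (QuotSMulTop.equivQuotTensor x P).symm (TensorProduct.mk R (R ⧸ Ideal.span {x}) P 1 a)
      = Submodule.Quotient.mk a := by
    rw [LinearEquiv.symm_apply_eq]
    rfl
  rw [this, Submodule.Quotient.mk_eq_zero, Submodule.mem_smul_pointwise_iff_exists]
  simp

lemma reg_tensor (M : Type) [AddCommGroup M] [Module R M] (P : Type) [AddCommGroup P] [Module R P]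
    [Module.Flat R P] (hM : ∀ m : M, x • m = 0 → m = 0) (a : M ⊗[R] P) (h : x • a = 0) : a = 0 := by
  have h1 : Function.Injective (x • (LinearMap.id : M →ₗ[R] M)) := by
    rw [injective_iff_map_eq_zero]
    simpa using hM
  have h2 := Module.Flat.rTensor_preserves_injective_linearMap (M := P) _ h1
  apply (injective_iff_map_eq_zero _).1 h2
  simpa [LinearMap.rTensor_smul] using h

lemma reg_flat (hR : ∀ r : R, x * r = 0 → r = 0) (P : Type) [AddCommGroup P] [Module R P]
    [Module.Flat R P] (a : P) (h : x • a = 0) : a = 0 := by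
  have := reg_tensor x R P (by simpa using hR) ((TensorProduct.lid R P).symm a)
    (by rw [← map_smul, h, map_zero])
  simpa using this

/-- Base change of a chain complex. -/
noncomputable def bc (C : ChainComplex (ModuleCat.{0} R) ℕ) :
    ChainComplex (ModuleCat.{0} (R ⧸ Ideal.span {x})) ℕ where
  X i := ModuleCat.of _ ((R ⧸ Ideal.span {x}) ⊗[R] C.X i)
  d i j := ModuleCat.ofHom ((C.d i j).hom.baseChange (R ⧸ Ideal.span {x}))
  shape i j h := by
    rw [C.shape i j h]
    ext : 1
    simp
  d_comp_d' i j k _ _ := by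
    rw [← ModuleCat.ofHom_comp, ← LinearMap.baseChange_comp, ← ModuleCat.hom_comp, C.d_comp_d]
    ext : 1
    simp

lemma bc_exact {A3 A2 A1 A0 : Type} [AddCommGroup A3] [AddCommGroup A2] [AddCommGroup A1]
    [AddCommGroup A0] [Module R A3] [Module R A2] [Module R A1] [Module R A0]
    (d3 : A3 →ₗ[R] A2) (d2 : A2 →ₗ[R] A1) (d1 : A1 →ₗ[R] A0)
    (h32 : Function.Exact d3 d2) (h21 : Function.Exact d2 d1)
    (hreg : ∀ a : A0, x • a = 0 → a = 0) :
    Function.Exact (d3.baseChange (R ⧸ Ideal.span {x})) (d2.baseChange (R ⧸ Ideal.span {x})) :=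
  chase x d3 d2 d1 (d3.baseChange (R ⧸ Ideal.span {x})).toAddMonoidHom
    (d2.baseChange (R ⧸ Ideal.span {x})).toAddMonoidHom
    (TensorProduct.mk R _ A3 1).toAddMonoidHom (TensorProduct.mk R _ A2 1).toAddMonoidHom
    (TensorProduct.mk R _ A1 1).toAddMonoidHom h32 h21 hreg (q1_surj x _) (q1_surj x _)
    (fun a => (q1_eq_zero x _ _).2 ⟨a, rfl⟩) (fun a h => (q1_eq_zero x _ _).1 h)
    (fun a => by simp) (fun a => by simp)

lemma tor_exact (M : Type) [AddCommGroup M] [Module R M]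
    {A3 A2 A1 A0 : Type} [AddCommGroup A3] [AddCommGroup A2] [AddCommGroup A1]
    [AddCommGroup A0] [Module R A3] [Module R A2] [Module R A1] [Module R A0] [Module.Flat R A0]
    (d3 : A3 →ₗ[R] A2) (d2 : A2 →ₗ[R] A1) (d1 : A1 →ₗ[R] A0)
    (h32 : Function.Exact (d3.lTensor M) (d2.lTensor M))
    (h21 : Function.Exact (d2.lTensor M) (d1.lTensor M))
    (hreg : ∀ m : M, x • m = 0 → m = 0) :
    Function.Exact (LinearMap.lTensor (M ⧸ (Ideal.span {x} • ⊤ : Submodule R M))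
        (d3.baseChange (R ⧸ Ideal.span {x})))
      (LinearMap.lTensor (M ⧸ (Ideal.span {x} • ⊤ : Submodule R M))
        (d2.baseChange (R ⧸ Ideal.span {x}))) :=
  chase x (d3.lTensor M) (d2.lTensor M) (d1.lTensor M)
    (LinearMap.lTensor (M ⧸ (Ideal.span {x} • ⊤ : Submodule R M))
        (d3.baseChange (R ⧸ Ideal.span {x}))).toAddMonoidHom
    (LinearMap.lTensor (M ⧸ (Ideal.span {x} • ⊤ : Submodule R M))
        (d2.baseChange (R ⧸ Ideal.span {x}))).toAddMonoidHom
    (qM x M A3) (qM x M A2) (qM x M A1) h32 h21 (reg_tensor x M A0 hreg)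
    (qM_surj x _ _) (qM_surj x _ _)
    (fun a => (qM_eq_zero x _ _ _).2 ⟨a, rfl⟩) (fun a h => (qM_eq_zero x _ _ _).1 h)
    (fun a => qM_comm x M _ _ d3 a) (fun a => qM_comm x M _ _ d2 a)

instance flatRes {N : ModuleCat.{0} R} (P : ProjectiveResolution N) (i : ℕ) :
    Module.Projective R (P.complex.X i) := (IsProjective.iff_projective _).2 (P.projective i)

lemma tor_quot (hR : ∀ r : R, x * r = 0 → r = 0)
    (M : Type) [AddCommGroup M] [Module R M] (hM : ∀ m : M, x • m = 0 → m = 0)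
    (K : ModuleCat.{0} R) (hK : ∀ m : K, x • m = 0 → m = 0)
    (h : TorEventuallyZero R (ModuleCat.of R M) K) :
    TorEventuallyZero (R ⧸ Ideal.span {x})
      (ModuleCat.of (R ⧸ Ideal.span {x}) (M ⧸ (Ideal.span {x} • ⊤ : Submodule R M)))
      (ModuleCat.of _ ((R ⧸ Ideal.span {x}) ⊗[R] K)) := by
  obtain ⟨n, hn⟩ := h
  let P := ProjectiveResolution.of K
  have hpr : ∀ i, Module.Projective (R ⧸ Ideal.span {x}) ((bc x P.complex).X i) := fun i =>
    inferInstanceAs (Module.Projective (R ⧸ Ideal.span {x})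
      ((R ⧸ Ideal.span {x}) ⊗[R] P.complex.X i))
  obtain ⟨Q, hQ⟩ := mkRes (N := ModuleCat.of _ ((R ⧸ Ideal.span {x}) ⊗[R] K)) (bc x P.complex)
    hpr (ModuleCat.ofHom ((aug P).baseChange _))
    (fun i => by
      cases i with
      | zero => exact bc_exact x _ _ _ (res_exact P 0) (aug_exact P) hK
      | succ i => exact bc_exact x _ _ _ (res_exact P (i+1)) (res_exact P i) (reg_flat x hR _))
    (lTensor_exact _ (aug_exact P) (aug_surj P))
    (LinearMap.lTensor_surjective _ (aug_surj P))
  refine ⟨n + 2, fun i hi => ?_⟩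
  obtain ⟨j, rfl⟩ : ∃ j, i = (j + 1) + 1 := ⟨i - 2, by omega⟩
  rw [tor_iff _ _ Q, hQ]
  have e1 := (tor_iff _ _ P (j+1)).1 (hn (j+1+1) (by omega))
  have e2 := (tor_iff _ _ P j).1 (hn (j+1) (by omega))
  exact tor_exact x M _ _ _ e1 e2 hM

end quot

lemma tor_shift {R : Type} [CommRing R] (M N F : ModuleCat.{0} R) [Module.Projective R F]
    (f : F →ₗ[R] N) (hf : Function.Surjective f) (h : TorEventuallyZero R M N) :
    TorEventuallyZero R M (ModuleCat.of R (LinearMap.ker f)) := by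
  obtain ⟨n, hn⟩ := h
  let P := ProjectiveResolution.of (ModuleCat.of R (LinearMap.ker f))
  let g : P.complex.X 0 ⟶ F := ModuleCat.ofHom ((LinearMap.ker f).subtype ∘ₗ aug P)
  have hg : Function.Exact (P.complex.d 1 0).hom g.hom := by
    intro a
    refine Iff.trans ?_ (aug_exact P a)
    exact (LinearMap.ker f).subtype.map_eq_zero_iff Subtype.val_injective
  have w : P.complex.d 1 0 ≫ g = 0 := by
    ext a
    exact hg.apply_apply_eq_zero a
  obtain ⟨Q, hQ⟩ := mkRes (N := N) (P.complex.augment g w)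
    (fun i => by
      cases i with
      | zero => assumption
      | succ i => exact flatRes P i)
    (ModuleCat.ofHom f)
    (fun i => by
      cases i with
      | zero => exact hg
      | succ i => exact res_exact P i)
    (by
      intro a
      constructor
      · intro ha
        obtain ⟨p, hp⟩ := aug_surj P ⟨a, ha⟩
        exact ⟨p, congrArg Subtype.val hp⟩
      · rintro ⟨p, rfl⟩
        exact (aug P p).2) hf
  refine ⟨n + 1, fun i hi => ?_⟩
  obtain ⟨j, rfl⟩ : ∃ j, i = j + 1 := ⟨i - 1, by omega⟩
  rw [tor_iff _ _ P]
  have := (tor_iff _ _ Q (j+1)).1 (hn _ (by omega))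
  rw [hQ] at this
  exact this

lemma pd_syz {S : Type} [CommRing S] {A B C : Type} [AddCommGroup A] [AddCommGroup B]
    [AddCommGroup C] [Module S A] [Module S B] [Module S C] [Module.Projective S B]
    (i : A →ₗ[S] B) (f : B →ₗ[S] C) (hi : Function.Injective i) (hex : Function.Exact i f)
    (hf : Function.Surjective f) (n : ℕ) (h : HasProjectiveDimensionLE (ModuleCat.of S C) (n+1)) :
    HasProjectiveDimensionLE (ModuleCat.of S A) n := by
  let T : ShortComplex (ModuleCat.{0} S) :=
    ShortComplex.mk (ModuleCat.ofHom i) (ModuleCat.ofHom f)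
      (ModuleCat.hom_ext (LinearMap.ext fun a => hex.apply_apply_eq_zero a))
  have hT : T.ShortExact :=
    { exact := (ShortComplex.ShortExact.moduleCat_exact_iff_function_exact _).2 hex
      mono_f := (ModuleCat.mono_iff_injective _).2 hi
      epi_g := (ModuleCat.epi_iff_surjective _).2 hf }
  have hPT : Projective T.X₂ :=
    (IsProjective.iff_projective _).1 (inferInstance : Module.Projective S B)
  exact (hT.hasProjectiveDimensionLT_X₃_iff n hPT).1 h

lemma pd_lift {R : Type} [CommRing R] [IsNoetherianRing R] [IsLocalRing R]
    (x : R) (hx : x ∈ maximalIdeal R) (hR : ∀ r : R, x * r = 0 → r = 0) (n : ℕ)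
    (K : Type) [AddCommGroup K] [Module R K] [Module.Finite R K]
    (hK : ∀ m : K, x • m = 0 → m = 0)
    (h : HasProjectiveDimensionLE
      (ModuleCat.of (R ⧸ Ideal.span {x}) ((R ⧸ Ideal.span {x}) ⊗[R] K)) n) :
    HasProjectiveDimensionLE (ModuleCat.of R K) n := by
  induction n generalizing K with
  | zero =>
    have hne : Ideal.span {x} ≠ ⊤ := fun h => by
      have := (Ideal.span_singleton_le_iff_mem _).2 hx
      rw [h] at this
      exact (maximalIdeal.isMaximal R).ne_top (top_le_iff.1 this)
    have : Nontrivial (R ⧸ Ideal.span {x}) := Ideal.Quotient.nontrivial_iff.2 hne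
    have : IsLocalRing (R ⧸ Ideal.span {x}) :=
      IsLocalRing.of_surjective' (Ideal.Quotient.mk _) Ideal.Quotient.mk_surjective
    rw [← projective_iff_hasProjectiveDimensionLE_zero, ← IsProjective.iff_projective] at h ⊢
    have h : Module.Projective (R ⧸ Ideal.span {x}) ((R ⧸ Ideal.span {x}) ⊗[R] K) := h
    have : Module.Free (R ⧸ Ideal.span {x}) ((R ⧸ Ideal.span {x}) ⊗[R] K) :=
      Module.free_of_flat_of_isLocalRing
    have hfr : Module.Free (R ⧸ Ideal.span {x}) (QuotSMulTop x K) :=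
      Module.Free.of_equiv ((QuotSMulTop.equivQuotTensor x K).extendScalarsOfSurjective
        Ideal.Quotient.mk_surjective).symm
    have : Module.FinitePresentation R K := Module.finitePresentation_of_finite R K
    have := (Module.free_quotSMulTop_iff_free R K
      (IsLocalRing.maximalIdeal_le_jacobson _ hx)
      (isSMulRegular_iff_right_eq_zero_of_smul.2 hK)).1 hfr
    exact (inferInstance : Module.Projective R K)
  | succ n ih =>
    rcases Module.exists_finite_presentation R K with ⟨F, _, _, _, _, f, hf⟩
    have hF := reg_flat x hR F
    have hK' : ∀ m : LinearMap.ker f, x • m = 0 → m = 0 := fun m hm =>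
      Subtype.ext (hF m.1 (congrArg Subtype.val hm))
    have hS := LinearMap.shortExact_shortComplexKer hf
    have hPF : Projective f.shortComplexKer.X₂ :=
      (IsProjective.iff_projective _).1 (inferInstance : Module.Projective R F)
    refine (hS.hasProjectiveDimensionLT_X₃_iff n hPF).2 ?_
    refine ih (LinearMap.ker f) hK' ?_
    let S := R ⧸ Ideal.span {x}
    have hi : Function.Injective ((LinearMap.ker f).subtype.baseChange S) := by
      rw [injective_iff_map_eq_zero]
      intro a ha
      obtain ⟨k, rfl⟩ := q1_surj x _ a
      have h1 : TensorProduct.mk R S F 1 k.1 = 0 := by simpa using ha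
      obtain ⟨y, hy⟩ := (q1_eq_zero x F k.1).1 h1
      have hy0 : f y = 0 := by
        apply hK
        rw [← map_smul, hy]
        exact k.2
      exact (q1_eq_zero x _ k).2 ⟨⟨y, hy0⟩, Subtype.ext hy⟩
    have hex : Function.Exact ((LinearMap.ker f).subtype.baseChange S) (f.baseChange S) :=
      lTensor_exact _ (LinearMap.exact_subtype_ker_map f) hf
    exact pd_syz _ _ hi hex (LinearMap.lTensor_surjective _ hf) n h

end TM

/-- If `M/xM` is a test module over `R/xR`, where `x` is a non zero-divisor on
both `R` and `M`, then `M` is a test module over `R`. -/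
theorem testModule_of_quot_testModule
    (R : Type) [CommRing R] [IsNoetherianRing R] [IsLocalRing R]
    (M : Type) [AddCommGroup M] [Module R M] [Module.Finite R M]
    (x : R) (hx : x ∈ maximalIdeal R)
    (hregR : ∀ r : R, x * r = 0 → r = 0)
    (hregM : ∀ m : M, x • m = 0 → m = 0)
    (h : IsTestModule (R ⧸ Ideal.span {x})
      (ModuleCat.of (R ⧸ Ideal.span {x}) (M ⧸ (Ideal.span {x} • ⊤ : Submodule R M)))) :
    IsTestModule R (ModuleCat.of R M) := by
  intro N hN hT
  rcases Module.exists_finite_presentation R N with ⟨F, _, _, _, _, f, hf⟩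
  have hF := TM.reg_flat x hregR F
  have hK : ∀ m : LinearMap.ker f, x • m = 0 → m = 0 := fun m hm =>
    Subtype.ext (hF m.1 (congrArg Subtype.val hm))
  have hPF' : Module.Projective R (ModuleCat.of R F) := (inferInstance : Module.Projective R F)
  have h1 := TM.tor_shift (ModuleCat.of R M) N (ModuleCat.of R F) f hf hT
  have h2 := TM.tor_quot x hregR M hregM _ hK h1
  have h3 := h _ (inferInstanceAs (Module.Finite (R ⧸ Ideal.span {x})
    (TensorProduct R (R ⧸ Ideal.span {x}) (LinearMap.ker f)))) h2
  rw [TM.finProjDim_iff] at h3 ⊢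
  obtain ⟨n, hn⟩ := h3
  have h4 := TM.pd_lift x hx hregR n (LinearMap.ker f) hK hn
  have hPF : Projective f.shortComplexKer.X₂ := (IsProjective.iff_projective _).1 hPF'
  exact ⟨n + 1, ((LinearMap.shortExact_shortComplexKer hf).hasProjectiveDimensionLT_X₃_iff n
    hPF).2 h4⟩
end

section
/- Let R be a commutative Noetherian local ring, M a finitely generated R-module, and x an element of m \ m^2 that is a non zero-divisor on both R and M. If M is a test module over R, then M/xM is a test module over R/xR. -/
open CategoryTheory IsLocalRing

open Limits
section general
universe v u
variable {C : Type u} [Category.{v} C] [Abelian C]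

lemma exact_epi_comp {S : ShortComplex C} (hS : S.Exact) {A : C} (e : A ⟶ S.X₁) [Epi e] :
    (ShortComplex.mk (e ≫ S.f) S.g (by simp)).Exact := by
  let α : ShortComplex.mk (e ≫ S.f) S.g (by simp) ⟶ S :=
    { τ₁ := e, τ₂ := 𝟙 _, τ₃ := 𝟙 _ }
  have : Epi α.τ₁ := ‹Epi e›
  have : IsIso α.τ₂ := inferInstanceAs (IsIso (𝟙 _))
  have : Mono α.τ₃ := inferInstanceAs (Mono (𝟙 _))
  exact (ShortComplex.exact_iff_of_epi_of_isIso_of_mono α).2 hS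

lemma exact_comp_mono {S : ShortComplex C} (hS : S.Exact) {A : C} (e : S.X₃ ⟶ A) [Mono e] :
    (ShortComplex.mk S.f (S.g ≫ e) (by simp)).Exact := by
  let α : S ⟶ ShortComplex.mk S.f (S.g ≫ e) (by simp) :=
    { τ₁ := 𝟙 _, τ₂ := 𝟙 _, τ₃ := e }
  have : Epi α.τ₁ := inferInstanceAs (Epi (𝟙 _))
  have : IsIso α.τ₂ := inferInstanceAs (IsIso (𝟙 _))
  have : Mono α.τ₃ := ‹Mono e›
  exact (ShortComplex.exact_iff_of_epi_of_isIso_of_mono α).1 hS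

noncomputable def resπ {Z : C} (P : ProjectiveResolution Z) : P.complex.X 0 ⟶ Z := P.π.f 0

lemma d_resπ {Z : C} (P : ProjectiveResolution Z) : P.complex.d 1 0 ≫ resπ P = 0 :=
  P.complex_d_comp_π_f_zero

instance {Z : C} (P : ProjectiveResolution Z) : Epi (resπ P) :=
  inferInstanceAs (Epi (P.π.f 0))

lemma exact_resπ {Z : C} (P : ProjectiveResolution Z) :
    (ShortComplex.mk _ _ (d_resπ P)).Exact := P.exact₀

lemma d_resπ_comp {Z Y : C} (P : ProjectiveResolution Z) (f : Z ⟶ Y) :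
    P.complex.d 1 0 ≫ resπ P ≫ f = 0 := by
  rw [← Category.assoc, d_resπ, zero_comp]

lemma resπ_comp_comp (S : ShortComplex C) (P : ProjectiveResolution S.X₁) :
    (resπ P ≫ S.f) ≫ S.g = 0 := by
  rw [Category.assoc, S.zero, comp_zero]

noncomputable def augRes (S : ShortComplex C) (hS : S.ShortExact) [Projective S.X₂]
    (P : ProjectiveResolution S.X₁) : ProjectiveResolution S.X₃ where
  complex := ChainComplex.augment P.complex (resπ P ≫ S.f) (d_resπ_comp P S.f)
  projective n := by
    obtain _ | n := n
    · exact inferInstanceAs (Projective S.X₂)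
    · exact inferInstanceAs (Projective (P.complex.X n))
  π := (ChainComplex.toSingle₀Equiv _ _).symm ⟨S.g, by
    rw [ChainComplex.augment_d_one_zero]
    exact resπ_comp_comp S P⟩
  quasiIso := ⟨fun n => by
    have := hS.mono_f
    have := hS.epi_g
    cases n with
    | zero =>
      rw [ChainComplex.quasiIsoAt₀_iff, ShortComplex.quasiIso_iff_of_zeros']
      · refine (ShortComplex.exact_and_epi_g_iff_of_iso ?_).2
          (⟨exact_epi_comp hS.exact (resπ P), hS.epi_g⟩)
        refine ShortComplex.isoMk (Iso.refl _) (Iso.refl _) (Iso.refl _) ?_ ?_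
        · erw [Category.id_comp, Category.comp_id]; rfl
        · erw [Category.id_comp, Category.comp_id]; 
          symm
          exact ChainComplex.toSingle₀Equiv_symm_apply_f_zero _ _
      all_goals rfl
    | succ n =>
      rw [quasiIsoAt_iff_exactAt']
      · rw [HomologicalComplex.exactAt_iff' _ (n + 1 + 1) (n + 1) n (by simp) (by simp)]
        cases n with
        | zero => exact exact_comp_mono (exact_resπ P) S.f
        | succ n => exact P.exact_succ n
      · apply ChainComplex.exactAt_succ_single_obj⟩

variable {D : Type*} [Category D] [Abelian D] [EnoughProjectives C]

lemma leftDerived_isZero_iff (F : C ⥤ D) [F.Additive] {T : C} (P : ProjectiveResolution T) (n : ℕ) :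
    IsZero ((F.leftDerived (n+1)).obj T) ↔
     ((ShortComplex.mk _ _ (P.complex.d_comp_d (n+2) (n+1) n)).map F).Exact := by
  rw [(P.isoLeftDerivedObj F (n+1)).isZero_iff]
  erw [← HomologicalComplex.exactAt_iff_isZero_homology,
    HomologicalComplex.exactAt_iff' _ (n + 1 + 1) (n + 1) n (by simp) (by simp)]
  rfl

lemma leftDerived_shift (F : C ⥤ D) [F.Additive] (S : ShortComplex C) (hS : S.ShortExact)
    [Projective S.X₂] (n : ℕ) :
    IsZero ((F.leftDerived (n+2)).obj S.X₃) ↔ IsZero ((F.leftDerived (n+1)).obj S.X₁) := by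
  rw [leftDerived_isZero_iff F (augRes S hS (ProjectiveResolution.of _)),
    leftDerived_isZero_iff F (ProjectiveResolution.of _)]
  rfl

lemma leftDerived_one (F : C ⥤ D) [F.Additive] (S : ShortComplex C) (hS : S.ShortExact)
    [Projective S.X₂] (P : ProjectiveResolution S.X₁) :
    IsZero ((F.leftDerived 1).obj S.X₃) ↔ 
    ((ShortComplex.mk (P.complex.d 1 0) (resπ P ≫ S.f) (d_resπ_comp P S.f) ).map F).Exact := by
  rw [leftDerived_isZero_iff F (augRes S hS P)]
  rfl

end general

section ext
variable (R : Type) [CommRing R]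

lemma ExtM_subsingleton_iff (i : ℕ) (N L : ModuleCat R) : Subsingleton (ExtM R i N L) ↔
    IsZero ((((linearYoneda R (ModuleCat R)).obj L).rightOp.leftDerived i).obj N) := by
  rw [← ModuleCat.isZero_iff_subsingleton]
  exact ⟨fun h => h.op, fun h => h.unop⟩

lemma TorM_subsingleton_iff (i : ℕ) (M N : ModuleCat R) : Subsingleton (TorM R i M N) ↔
    IsZero ((((MonoidalCategory.tensoringLeft (ModuleCat R)).obj M).leftDerived i).obj N) := by
  rw [← ModuleCat.isZero_iff_subsingleton]
  exact Iff.rfl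

lemma projective_of_ext_one (N : ModuleCat R) (h : ∀ L, Subsingleton (ExtM R 1 N L)) :
    Projective N := by
  let S := N.projectiveShortComplex
  have hS : S.ShortExact := N.shortExact_projectiveShortComplex
  have : Projective S.X₂ := inferInstanceAs (Projective N.projectiveShortComplex.X₂)
  let Q := ProjectiveResolution.of S.X₁
  have h1 := (ExtM_subsingleton_iff R 1 N S.X₁).1 (h S.X₁)
  have h2 := ((leftDerived_one _ S hS Q).1 h1).unop
  rw [ShortComplex.moduleCat_exact_iff] at h2
  obtain ⟨r, hr'⟩ : ∃ r : S.X₂ ⟶ S.X₁, (resπ Q ≫ S.f) ≫ r = resπ Q :=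
    h2 (resπ Q) (d_resπ Q)
  have hr2 : S.f ≫ r = 𝟙 _ := by
    rw [← cancel_epi (resπ Q), ← Category.assoc, hr', Category.comp_id]
  have sp := ShortComplex.Splitting.ofExactOfRetraction S hS.exact r hr2 hS.epi_g
  exact (Retract.mk sp.s S.g sp.s_g).projective

lemma projDimLE_iff (N : ModuleCat R) (n : ℕ) :
    ProjDimLE R N n ↔ HasProjectiveDimensionLE N n := by
  induction n generalizing N with
  | zero =>
    rw [← projective_iff_hasProjectiveDimensionLE_zero]
    constructor
    · intro h
      exact projective_of_ext_one R N (fun L => h 1 (by simp) L)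
    · intro h i hi L
      obtain ⟨j, rfl⟩ := Nat.exists_eq_succ_of_ne_zero hi.ne'
      rw [← ModuleCat.isZero_iff_subsingleton]
      exact isZero_Ext_succ_of_projective N L j
  | succ n ih =>
    let S := N.projectiveShortComplex
    have hS : S.ShortExact := N.shortExact_projectiveShortComplex
    have : Projective S.X₂ := inferInstanceAs (Projective N.projectiveShortComplex.X₂)
    have e : ProjDimLE R N (n+1) ↔ ProjDimLE R S.X₁ n := by
      have key : ∀ j L, Subsingleton (ExtM R (j+2) N L) ↔ Subsingleton (ExtM R (j+1) S.X₁ L) := by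
        intro j L
        rw [ExtM_subsingleton_iff, ExtM_subsingleton_iff]
        exact leftDerived_shift _ S hS j
      constructor
      · intro h i hi L
        obtain ⟨j, rfl⟩ := Nat.exists_eq_succ_of_ne_zero (Nat.ne_zero_of_lt hi)
        exact (key j L).1 (h (j+2) (by omega) L)
      · intro h i hi L
        obtain ⟨j, rfl⟩ : ∃ j, i = j + 2 := ⟨i-2, by omega⟩
        exact (key j L).2 (h (j+1) (by omega) L)
    rw [e, ih]
    exact (hS.hasProjectiveDimensionLT_X₃_iff n inferInstance).symm

end ext

section tor
open TensorProduct
variable {R : Type} [CommRing R] (M : Type) [AddCommGroup M] [Module R M]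

/-- Vanishing of Tor, unbundled. -/
def TV (R : Type) [CommRing R] (i : ℕ) (M T : Type) [AddCommGroup M] [Module R M]
    [AddCommGroup T] [Module R T] : Prop :=
  Subsingleton (TorM R i (ModuleCat.of R M) (ModuleCat.of R T))

section ses
variable {K F T : Type} [AddCommGroup K] [Module R K] [AddCommGroup F] [Module R F]
  [AddCommGroup T] [Module R T]

lemma ses_of (f : K →ₗ[R] F) (g : F →ₗ[R] T) (hf : Function.Injective f)
    (hg : Function.Surjective g) (hfg : Function.Exact f g) :
    (ShortComplex.mk (ModuleCat.ofHom f) (ModuleCat.ofHom g) (by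
      ext x; exact hfg.apply_apply_eq_zero x)).ShortExact where
  exact := (ShortComplex.ShortExact.moduleCat_exact_iff_function_exact _).2 hfg
  mono_f := (ModuleCat.mono_iff_injective _).2 hf
  epi_g := (ModuleCat.epi_iff_surjective _).2 hg

lemma tor_shift (f : K →ₗ[R] F) (g : F →ₗ[R] T) (hf : Function.Injective f)
    (hg : Function.Surjective g) (hfg : Function.Exact f g) [Module.Projective R F] (i : ℕ) :
    TV R (i+2) M T ↔ TV R (i+1) M K := by
  have hS := ses_of f g hf hg hfg
  have : Projective (ModuleCat.of R F) := (IsProjective.iff_projective F).1 inferInstance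
  rw [TV, TV, TorM_subsingleton_iff, TorM_subsingleton_iff]
  exact leftDerived_shift _ _ hS i

lemma tor_one (f : K →ₗ[R] F) (g : F →ₗ[R] T) (hf : Function.Injective f)
    (hg : Function.Surjective g) (hfg : Function.Exact f g) [Module.Projective R F] :
    TV R 1 M T ↔ Function.Injective (f.lTensor M) := by
  have hS := ses_of f g hf hg hfg
  have : Projective (ModuleCat.of R F) := (IsProjective.iff_projective F).1 inferInstance
  rw [TV, TorM_subsingleton_iff]
  let Q := ProjectiveResolution.of (ModuleCat.of R K)
  refine (leftDerived_one _ _ hS Q).trans ?_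
  rw [ShortComplex.ShortExact.moduleCat_exact_iff_function_exact]
  let d := (Q.complex.d 1 0).hom
  let p := (resπ Q).hom
  have hp : Function.Surjective p := (ModuleCat.epi_iff_surjective _).1 inferInstance
  have hdp : Function.Exact d p :=
    (ShortComplex.ShortExact.moduleCat_exact_iff_function_exact _).1 (exact_resπ Q)
  have ht := lTensor_exact M hdp hp
  have htp := LinearMap.lTensor_surjective M hp
  change Function.Exact (d.lTensor M) ((f ∘ₗ p).lTensor M) ↔ _
  rw [LinearMap.lTensor_comp]
  constructor
  · intro h
    rw [injective_iff_map_eq_zero]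
    intro a ha
    obtain ⟨b, rfl⟩ := htp a
    exact (ht b).2 ((h b).1 ha)
  · intro h b
    rw [← ht b]
    exact ⟨fun hb => h (by simpa using hb), fun hb => by simp [hb]⟩

lemma tor_retract {A B : Type} [AddCommGroup A] [Module R A] [AddCommGroup B] [Module R B]
    (s : A →ₗ[R] B) (r : B →ₗ[R] A) (h : r ∘ₗ s = LinearMap.id) (i : ℕ)
    (hB : TV R i M B) : TV R i M A := by
  rw [TV, TorM_subsingleton_iff] at hB ⊢
  let ρ : Retract (ModuleCat.of R A) (ModuleCat.of R B) :=
    ⟨ModuleCat.ofHom s, ModuleCat.ofHom r, by rw [← ModuleCat.ofHom_comp, h]; rfl⟩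
  let ρ' := ρ.map (((MonoidalCategory.tensoringLeft (ModuleCat R)).obj (ModuleCat.of R M)).leftDerived i)
  rw [IsZero.iff_id_eq_zero, ← ρ'.retract, hB.eq_of_tgt ρ'.i 0, zero_comp]

lemma tor_ext_aux {P F' L : Type} [AddCommGroup P] [Module R P] [Module.Projective R P] [AddCommGroup F'] [Module R F'] [AddCommGroup L] [Module R L]
    (f : F' →ₗ[R] L) (g : L →ₗ[R] K) (hf : Function.Injective f)
    (hg : Function.Surjective g) (hfg : Function.Exact f g) [Module.Projective R F'] (i : ℕ)
    (q : P →ₗ[R] L) (hq : Function.Surjective q)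
    (h : TV R (i+1) M K) : TV R (i+1) M L := by
  let L' := LinearMap.ker q
  let K' := LinearMap.ker (g ∘ₗ q)
  have hle : L' ≤ K' := LinearMap.ker_le_ker_comp q g
  let s : L' →ₗ[R] K' := Submodule.inclusion hle
  have hmem : ∀ k : K', q k ∈ LinearMap.range f := fun k => (hfg _).1 k.2
  let e := LinearEquiv.ofInjective f hf
  let p : K' →ₗ[R] F' := e.symm.toLinearMap ∘ₗ
    (LinearMap.codRestrict (LinearMap.range f) (q ∘ₗ K'.subtype) hmem)
  have hp : ∀ k, f (p k) = q k := fun k => by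
    have := congrArg Subtype.val (e.apply_symm_apply ⟨q k, hmem k⟩)
    exact this
  have psurj : Function.Surjective p := fun y => by
    obtain ⟨z, hz⟩ := hq (f y)
    refine ⟨⟨z, ?_⟩, hf ?_⟩
    · change g (q z) = 0
      rw [hz]; exact hfg.apply_apply_eq_zero y
    · rw [hp]; exact hz
  obtain ⟨σ, hσ⟩ := Module.projective_lifting_property p LinearMap.id psurj
  have hσ' : ∀ y, p (σ y) = y := fun y => LinearMap.congr_fun hσ y
  let r : K' →ₗ[R] L' := LinearMap.codRestrict L' (K'.subtype ∘ₗ (LinearMap.id - σ ∘ₗ p)) (by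
    intro k
    have h0 : q (k : P) - q (σ (p k) : P) = 0 := by
      rw [← hp, ← hp, hσ', sub_self]
    rw [← map_sub] at h0
    refine LinearMap.mem_ker.2 ?_
    rw [← h0]
    congr 1)
  have hrs : r ∘ₗ s = LinearMap.id := by
    ext1 l
    apply Subtype.ext
    have h1 : ((r (s l) : L') : P) = (s l : P) - (σ (p (s l)) : P) := by
      rw [LinearMap.codRestrict_apply, LinearMap.comp_apply, LinearMap.sub_apply, map_sub]
      rfl
    rw [LinearMap.comp_apply, h1]
    have : p (s l) = 0 := hf (by rw [hp, map_zero]; exact l.2)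
    rw [this, map_zero, Submodule.coe_zero, sub_zero]; rfl
  have hgq : Function.Surjective (g ∘ₗ q) := hg.comp hq
  have e1 : Function.Exact K'.subtype (g ∘ₗ q) := LinearMap.exact_subtype_ker_map _
  have e2 : Function.Exact L'.subtype q := LinearMap.exact_subtype_ker_map _
  cases i with
  | zero =>
    rw [tor_one M L'.subtype q L'.subtype_injective hq e2]
    have h1 := (tor_one M K'.subtype _ K'.subtype_injective hgq e1).1 h
    have : L'.subtype = K'.subtype ∘ₗ s := rfl
    rw [this, LinearMap.lTensor_comp]
    refine h1.comp ?_
    refine Function.LeftInverse.injective (g := r.lTensor M) fun z => ?_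
    rw [← LinearMap.comp_apply, ← LinearMap.lTensor_comp, hrs, LinearMap.lTensor_id]; rfl
  | succ i =>
    rw [tor_shift M L'.subtype q L'.subtype_injective hq e2]
    have h1 := (tor_shift M K'.subtype _ K'.subtype_injective hgq e1 i).1 h
    exact tor_retract M s r hrs _ h1

lemma tor_ext {F' L : Type} [AddCommGroup F'] [Module R F'] [AddCommGroup L] [Module R L]
    (f : F' →ₗ[R] L) (g : L →ₗ[R] K) (hf : Function.Injective f)
    (hg : Function.Surjective g) (hfg : Function.Exact f g) [Module.Projective R F'] (i : ℕ)
    (h : TV R (i+1) M K) : TV R (i+1) M L :=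
  tor_ext_aux M f g hf hg hfg i (Finsupp.linearCombination R id)
    (Finsupp.linearCombination_id_surjective R L) h

end ses
end tor

section transfer
open TensorProduct
variable {R S : Type} [CommRing R] [CommRing S] [Algebra R S]
  {M B : Type} [AddCommGroup M] [Module R M] [AddCommGroup B] [Module S B]

lemma inj_transfer (e : S ⊗[R] M ≃ₗ[S] B) {K F : Type} [AddCommGroup K] [AddCommGroup F]
    [Module R K] [Module S K] [IsScalarTower R S K] [Module R F] [Module S F]
    [IsScalarTower R S F] (f : K →ₗ[S] F) (h : Function.Injective (f.lTensor B)) :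
    Function.Injective ((f.restrictScalars R).lTensor M) := by
  rw [LinearMap.lTensor_inj_iff_rTensor_inj] at h ⊢
  let θK : K ⊗[S] B ≃ₗ[S] K ⊗[R] M := (TensorProduct.congr (LinearEquiv.refl S K) e.symm).trans
    (AlgebraTensorModule.cancelBaseChange R S S K M)
  let θF : F ⊗[S] B ≃ₗ[S] F ⊗[R] M := (TensorProduct.congr (LinearEquiv.refl S F) e.symm).trans
    (AlgebraTensorModule.cancelBaseChange R S S F M)
  have hK : ∀ k m, θK.symm (k ⊗ₜ m) = k ⊗ₜ e (1 ⊗ₜ m) := fun k m => by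
    rw [LinearEquiv.symm_apply_eq]; simp [θK]
  have hF : ∀ k m, θF.symm (k ⊗ₜ m) = k ⊗ₜ e (1 ⊗ₜ m) := fun k m => by
    rw [LinearEquiv.symm_apply_eq]; simp [θF]
  have key : ∀ z, θF.symm ((f.restrictScalars R).rTensor M z) = f.rTensor B (θK.symm z) := by
    intro z
    induction z with
    | zero => simp
    | add a b ha hb => simp only [map_add, ha, hb]
    | tmul k m => rw [hK, LinearMap.rTensor_tmul, LinearMap.rTensor_tmul, hF]; rfl
  intro a b hab
  apply θK.symm.injective
  apply h
  rw [← key, ← key, hab]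

lemma transfer_step (e : S ⊗[R] M ≃ₗ[S] B) (x : R) (hregM : ∀ m : M, x • m = 0 → m = 0)
    {Q F T : Type} [AddCommGroup Q] [AddCommGroup F] [AddCommGroup T]
    [Module R Q] [Module.Projective R Q] [Module R F] [Module S F] [IsScalarTower R S F]
    [Module.Projective S F] [Module R T] [Module S T] [IsScalarTower R S T]
    (hregQ : ∀ q : Q, x • q = 0 → q = 0)
    (g : F →ₗ[S] T) (hg : Function.Surjective g)
    (π : Q →ₗ[R] F) (hπ : Function.Surjective π) (hk : ∀ q, π q = 0 ↔ ∃ q', x • q' = q)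
    (i : ℕ) (h : TV S (i+1) B T)
    (ih : ∀ j, i = j + 1 → TV S (j+1) B (LinearMap.ker g) → TV R (j+1) M (LinearMap.ker g)) :
    TV R (i+1) M T := by
  let K := LinearMap.ker g
  let φ : Q →ₗ[R] T := g.restrictScalars R ∘ₗ π
  let L := LinearMap.ker φ
  let ι : Q →ₗ[R] L := LinearMap.codRestrict L (x • LinearMap.id) (fun q => by
    have : π (x • q) = 0 := (hk _).2 ⟨q, rfl⟩
    change g (π (x • q)) = 0
    rw [this, map_zero])
  let ρ : L →ₗ[R] K :=
    { toFun := fun l => ⟨π l, l.2⟩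
      map_add' := fun a b => Subtype.ext (map_add π _ _)
      map_smul' := fun a b => Subtype.ext (map_smul π _ _) }
  have hι : Function.Injective ι := by
    rw [injective_iff_map_eq_zero]
    intro q hq
    exact hregQ q (congrArg Subtype.val hq)
  have hρ : Function.Surjective ρ := by
    rintro ⟨k, hk⟩
    obtain ⟨q, rfl⟩ := hπ k
    exact ⟨⟨q, hk⟩, rfl⟩
  have hιρ : Function.Exact ι ρ := by
    intro l
    constructor
    · intro hl
      obtain ⟨q, hq⟩ := (hk l).1 (congrArg Subtype.val hl)
      exact ⟨q, Subtype.ext hq⟩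
    · rintro ⟨q, rfl⟩
      exact Subtype.ext ((hk _).2 ⟨q, rfl⟩)
  have hφ : Function.Surjective φ := hg.comp hπ
  have e1 : Function.Exact K.subtype g := LinearMap.exact_subtype_ker_map _
  have e2 : Function.Exact L.subtype φ := LinearMap.exact_subtype_ker_map _
  cases i with
  | succ i =>
    rw [tor_shift M L.subtype φ L.subtype_injective hφ e2]
    have h1 := (tor_shift B K.subtype g K.subtype_injective hg e1 i).1 h
    exact tor_ext M ι ρ hι hρ hιρ i (ih i rfl h1)
  | zero =>
    rw [tor_one M L.subtype φ L.subtype_injective hφ e2]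
    have h1 := inj_transfer e _ ((tor_one B K.subtype g K.subtype_injective hg e1).1 h)
    rw [injective_iff_map_eq_zero]
    intro z hz
    have hz1 : ρ.lTensor M z = 0 := by
      apply h1
      rw [map_zero, ← LinearMap.comp_apply, ← LinearMap.lTensor_comp]
      have : (K.subtype.restrictScalars R) ∘ₗ ρ = π ∘ₗ L.subtype := rfl
      rw [this, LinearMap.lTensor_comp, LinearMap.comp_apply, hz, map_zero]
    obtain ⟨w, rfl⟩ := ((lTensor_exact M hιρ hρ) z).1 hz1
    have hinj : Function.Injective ((x • LinearMap.id : M →ₗ[R] M).rTensor Q) := by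
      apply Module.Flat.rTensor_preserves_injective_linearMap
      rw [injective_iff_map_eq_zero]
      exact hregM
    have : w = 0 := by
      apply hinj
      rw [map_zero, LinearMap.rTensor_smul, LinearMap.rTensor_id]
      rw [← LinearMap.comp_apply, ← LinearMap.lTensor_comp] at hz
      have h3 : L.subtype ∘ₗ ι = x • LinearMap.id := rfl
      rwa [h3, LinearMap.lTensor_smul, LinearMap.lTensor_id] at hz
    rw [this, map_zero]

lemma transfer (e : S ⊗[R] M ≃ₗ[S] B) (x : R) (hregM : ∀ m : M, x • m = 0 → m = 0)
    (hregR : ∀ r : R, x * r = 0 → r = 0)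
    (hs : Function.Surjective (algebraMap R S))
    (hk : ∀ r, algebraMap R S r = 0 ↔ ∃ r', x * r' = r) (i : ℕ) :
    ∀ (T : Type) [AddCommGroup T] [Module R T] [Module S T] [IsScalarTower R S T],
      TV S (i+1) B T → TV R (i+1) M T := by
  induction i using Nat.strong_induction_on with
  | _ i ih =>
  intro T _ _ _ _ h
  refine transfer_step (Q := T →₀ R) (F := T →₀ S) e x hregM ?_ (Finsupp.linearCombination S id)
    (Finsupp.linearCombination_id_surjective S T)
    (Finsupp.mapRange.linearMap (Algebra.linearMap R S)) ?_ ?_ i h ?_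
  · intro q hq
    ext t
    exact hregR _ (DFunLike.congr_fun hq t)
  · exact Finsupp.mapRange_surjective _ (map_zero _) hs
  · intro q
    constructor
    · intro hq
      have : ∀ t, ∃ r', x * r' = q t := fun t => (hk _).1 (DFunLike.congr_fun hq t)
      choose c hc using this
      refine ⟨Finsupp.onFinset q.support c (fun t ht => ?_), ?_⟩
      · rw [Finsupp.mem_support_iff]
        intro h0
        exact ht (hregR _ ((hc t).trans h0))
      · ext t; exact hc t
    · rintro ⟨q', rfl⟩
      ext t
      exact (hk _).2 ⟨q' t, rfl⟩
  · rintro j rfl h'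
    exact ih j (by omega) _ h'
end transfer

section descent
open TensorProduct
variable {R S : Type} [CommRing R] [CommRing S] [Algebra R S]

lemma pi_ker (x : R) (hk : ∀ r, algebraMap R S r = 0 ↔ ∃ r', x * r' = r) {ι : Type} (q : ι → R) :
    (Algebra.linearMap R S).compLeft ι q = 0 ↔ ∃ q', x • q' = q := by
  constructor
  · intro hq
    have : ∀ t, ∃ r', x * r' = q t := fun t => (hk _).1 (congrFun hq t)
    choose c hc using this
    exact ⟨c, funext hc⟩
  · rintro ⟨q', rfl⟩
    ext t
    exact (hk _).2 ⟨q' t, rfl⟩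

lemma pi_surj (hs : Function.Surjective (algebraMap R S)) (ι : Type) :
    Function.Surjective ((Algebra.linearMap R S).compLeft ι) := by
  intro q
  choose c hc using fun t => hs (q t)
  exact ⟨c, funext hc⟩

lemma lt_one_of_projective (P : Type) [AddCommGroup P] [Module R P] [Module.Projective R P] :
    HasProjectiveDimensionLT (ModuleCat.of R P) 1 :=
  projective_iff_hasProjectiveDimensionLT_one.1 ((IsProjective.iff_projective P).1 inferInstance)

lemma pd_free (x : R) (hregR : ∀ r : R, x * r = 0 → r = 0)
    (hs : Function.Surjective (algebraMap R S))
    (hk : ∀ r, algebraMap R S r = 0 ↔ ∃ r', x * r' = r) (ι : Type) [Finite ι] :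
    HasProjectiveDimensionLT (ModuleCat.of R (ι → S)) 2 := by
  have hS := ses_of (x • LinearMap.id : (ι → R) →ₗ[R] (ι → R)) ((Algebra.linearMap R S).compLeft ι)
    (by
      rw [injective_iff_map_eq_zero]
      intro q hq
      ext t
      exact hregR _ (congrFun hq t)) (pi_surj hs ι) (fun q => by
      rw [pi_ker x hk q]
      simp [Set.mem_range])
  have h1 := lt_one_of_projective (R := R) (ι → R)
  exact hS.hasProjectiveDimensionLT_X₃ 1 h1 (hasProjectiveDimensionLT_of_ge _ 1 2 (by omega))

/-- minimal presentations -/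
lemma exists_minimal [IsLocalRing R] (T : Type) [AddCommGroup T] [Module R T]
    [Module.Finite R T] : ∃ (n : ℕ) (f : (Fin n → R) →ₗ[R] T), Function.Surjective f ∧
      ∀ v, f v = 0 → ∀ i, v i ∈ maximalIdeal R := by
  let b := Module.finBasis (ResidueField R) (ResidueField R ⊗[R] T)
  have hsurj : Function.Surjective (TensorProduct.mk R (ResidueField R) T 1) :=
    TensorProduct.mk_surjective R T (ResidueField R) IsLocalRing.residue_surjective
  choose t ht using fun i => hsurj (b i)
  have hspan := IsLocalRing.span_eq_top_of_tmul_eq_basis t b ht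
  refine ⟨_, Fintype.linearCombination R t, ?_, ?_⟩
  · rw [← LinearMap.range_eq_top, Fintype.range_linearCombination, hspan]
  · intro v hv i
    have h0 : TensorProduct.mk R (ResidueField R) T 1 (Fintype.linearCombination R t v) = 0 := by
      rw [hv, map_zero]
    rw [Fintype.linearCombination_apply, map_sum] at h0
    have h1 : ∑ j, (residue R (v j)) • b j = 0 := by
      rw [← h0]
      refine Finset.sum_congr rfl fun j _ => ?_
      rw [map_smul, ht]
      exact algebraMap_smul (ResidueField R) (v j) (b j)
    have := Fintype.linearIndependent_iff.1 b.linearIndependent _ h1 i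
    exact (residue_eq_zero_iff _).1 this

lemma mem_smul_of_tmul_eq_zero [IsLocalRing R] {L : Type} [AddCommGroup L] [Module R L] (l : L)
    (h : (1 : ResidueField R) ⊗ₜ[R] l = 0) : l ∈ (maximalIdeal R • ⊤ : Submodule R L) := by
  have h2 := congrArg (TensorProduct.quotTensorEquivQuotSMul L (maximalIdeal R)) h
  have h3 : TensorProduct.quotTensorEquivQuotSMul L (maximalIdeal R)
      ((1 : ResidueField R) ⊗ₜ[R] l) = Submodule.Quotient.mk l := by
    have := TensorProduct.quotTensorEquivQuotSMul_mk_tmul (maximalIdeal R) (1 : R) l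
    rw [one_smul] at this
    exact this
  exact (Submodule.Quotient.mk_eq_zero _).1 (h3.symm.trans (h2.trans (map_zero _)))

lemma base_case [IsNoetherianRing R] [IsLocalRing R] (x : R) (hx : x ∈ maximalIdeal R)
    (hx2 : x ∉ (maximalIdeal R) ^ 2)
    (hregR : ∀ r : R, x * r = 0 → r = 0)
    (hs : Function.Surjective (algebraMap R S))
    (hk : ∀ r, algebraMap R S r = 0 ↔ ∃ r', x * r' = r)
    (T : Type) [AddCommGroup T] [Module R T] [Module S T] [IsScalarTower R S T]
    [Module.Finite R T] (h : HasProjectiveDimensionLT (ModuleCat.of R T) 2) :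
    Module.Projective S T := by
  obtain ⟨n, f, hf, hmin⟩ := exists_minimal (R := R) T
  let L := LinearMap.ker f
  have hS := ses_of L.subtype f L.subtype_injective hf (LinearMap.exact_subtype_ker_map _)
  have hL := hS.hasProjectiveDimensionLT_X₁ 1 (lt_one_of_projective _) h
  have : Module.Projective R L :=
    (IsProjective.iff_projective _).2 (projective_iff_hasProjectiveDimensionLT_one.2 hL)
  have : Module.Free R L := Module.free_of_flat_of_isLocalRing
  have hxT : ∀ t : T, x • t = 0 := fun t => by
    rw [← algebraMap_smul S x t, (hk x).2 ⟨1, mul_one x⟩, zero_smul]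
  let φ : (Fin n → R) →ₗ[R] L := LinearMap.codRestrict L (x • LinearMap.id) (fun q => by
    change f (x • q) = 0
    rw [map_smul, hxT])
  have hφ : Function.Injective (φ.lTensor (ResidueField R)) := by
    rw [injective_iff_map_eq_zero]
    intro z hz
    obtain ⟨v, rfl⟩ := TensorProduct.mk_surjective R (Fin n → R) (ResidueField R)
      IsLocalRing.residue_surjective z
    have hm := mem_smul_of_tmul_eq_zero (φ v) hz
    have hcoord : ∀ l ∈ (maximalIdeal R • ⊤ : Submodule R L), ∀ i,
        (l : Fin n → R) i ∈ (maximalIdeal R) ^ 2 := by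
      intro l hl i
      refine Submodule.smul_induction_on hl ?_ ?_
      · intro r hr y _
        rw [pow_two]
        exact Ideal.mul_mem_mul hr (hmin y y.2 i)
      · intro a b ha hb
        exact Ideal.add_mem _ ha hb
    have hv : ∀ i, v i ∈ maximalIdeal R := by
      intro i
      by_contra hvi
      have hu : IsUnit (v i) := by
        by_contra h'
        exact hvi ((mem_maximalIdeal _).2 h')
      have : x * v i ∈ (maximalIdeal R) ^ 2 := hcoord _ hm i
      exact hx2 ((Ideal.mul_unit_mem_iff_mem _ hu).1 this)
    rw [pi_eq_sum_univ' v, map_sum]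
    refine Finset.sum_eq_zero fun i _ => ?_
    rw [map_smul, ← algebraMap_smul (ResidueField R) (v i)]
    have : algebraMap R (ResidueField R) (v i) = 0 := (residue_eq_zero_iff _).2 (hv i)
    rw [this, zero_smul]
  obtain ⟨l', hl'⟩ := (IsLocalRing.split_injective_iff_lTensor_residueField_injective φ).2 hφ
  have hker : LinearMap.ker f = LinearMap.ker ((Algebra.linearMap R S).compLeft (Fin n)) := by
    ext q
    rw [LinearMap.mem_ker, LinearMap.mem_ker, pi_ker x hk]
    constructor
    · intro hq
      let l : L := ⟨q, hq⟩
      refine ⟨l' l, ?_⟩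
      have h1 : φ q = x • l := Subtype.ext rfl
      rw [← map_smul, ← h1]
      exact LinearMap.congr_fun hl' q
    · rintro ⟨q', rfl⟩
      rw [map_smul, hxT]
  let e : (Fin n → S) ≃ₗ[R] T :=
    (LinearMap.quotKerEquivOfSurjective _ (pi_surj hs (Fin n))).symm.trans
      ((Submodule.quotEquivOfEq _ _ hker.symm).trans (LinearMap.quotKerEquivOfSurjective _ hf))
  exact Module.Projective.of_equiv (LinearEquiv.extendScalarsOfSurjective hs e)

lemma descent [IsNoetherianRing R] [IsLocalRing R] [IsNoetherianRing S]
    (x : R) (hx : x ∈ maximalIdeal R)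
    (hx2 : x ∉ (maximalIdeal R) ^ 2)
    (hregR : ∀ r : R, x * r = 0 → r = 0)
    (hs : Function.Surjective (algebraMap R S))
    (hk : ∀ r, algebraMap R S r = 0 ↔ ∃ r', x * r' = r) (n : ℕ) :
    ∀ (T : Type) [AddCommGroup T] [Module R T] [Module S T] [IsScalarTower R S T]
    [Module.Finite S T], HasProjectiveDimensionLT (ModuleCat.of R T) (n + 2) →
    ∃ m, HasProjectiveDimensionLT (ModuleCat.of S T) m := by
  induction n with
  | zero =>
    intro T _ _ _ _ _ h
    have : Module.Finite R S := Module.Finite.of_surjective (Algebra.linearMap R S) hs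
    have : Module.Finite R T := Module.Finite.trans S T
    have := base_case x hx hx2 hregR hs hk T h
    exact ⟨1, lt_one_of_projective T⟩
  | succ n ih =>
    intro T _ _ _ _ _ h
    obtain ⟨r, g, hg⟩ := Module.Finite.exists_fin' S T
    let K := LinearMap.ker g
    have e1 : Function.Exact K.subtype g := LinearMap.exact_subtype_ker_map _
    have hS := ses_of K.subtype g K.subtype_injective hg e1
    have hR := ses_of (K.subtype.restrictScalars R) (g.restrictScalars R) K.subtype_injective hg e1
    have hF := pd_free x hregR hs hk (Fin r)
    have hK := hR.hasProjectiveDimensionLT_X₁ (n+2)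
      (hasProjectiveDimensionLT_of_ge _ 2 (n+2) (by omega)) h
    obtain ⟨m, hm⟩ := ih K hK
    have hF' := lt_one_of_projective (R := S) (Fin r → S)
    exact ⟨m+1, hS.hasProjectiveDimensionLT_X₃ m hm
      (hasProjectiveDimensionLT_of_ge _ 1 (m+1) (by omega))⟩
end descent

/-- If `M` is a test module over `R` and `x ∈ 𝔪 \ 𝔪²` is a non zero-divisor on
both `R` and `M`, then `M/xM` is a test module over `R/xR`. -/
theorem quot_testModule_of_testModule
    (R : Type) [CommRing R] [IsNoetherianRing R] [IsLocalRing R]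
    (M : Type) [AddCommGroup M] [Module R M] [Module.Finite R M]
    (x : R) (hx : x ∈ maximalIdeal R) (hx2 : x ∉ (maximalIdeal R) ^ 2)
    (hregR : ∀ r : R, x * r = 0 → r = 0)
    (hregM : ∀ m : M, x • m = 0 → m = 0)
    (h : IsTestModule R (ModuleCat.of R M)) :
    IsTestModule (R ⧸ Ideal.span {x})
      (ModuleCat.of (R ⧸ Ideal.span {x}) (M ⧸ (Ideal.span {x} • ⊤ : Submodule R M))) := by
  have hs : Function.Surjective (algebraMap R (R ⧸ Ideal.span {x})) := Ideal.Quotient.mk_surjective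
  have hk : ∀ r, algebraMap R (R ⧸ Ideal.span {x}) r = 0 ↔ ∃ r', x * r' = r := fun r => by
    rw [Ideal.Quotient.algebraMap_eq, Ideal.Quotient.eq_zero_iff_mem, Ideal.mem_span_singleton]
    exact ⟨fun ⟨c, hc⟩ => ⟨c, hc.symm⟩, fun ⟨c, hc⟩ => ⟨c, hc.symm⟩⟩
  let e := LinearEquiv.extendScalarsOfSurjective hs
    (TensorProduct.quotTensorEquivQuotSMul M (Ideal.span {x}))
  intro N hN hT
  obtain ⟨n, hn⟩ := hT
  letI : Module R N := Module.compHom N (algebraMap R (R ⧸ Ideal.span {x}))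
  haveI : IsScalarTower R (R ⧸ Ideal.span {x}) N := IsScalarTower.of_algebraMap_smul fun _ _ => rfl
  haveI : Module.Finite R (R ⧸ Ideal.span {x}) :=
    Module.Finite.of_surjective (Algebra.linearMap R (R ⧸ Ideal.span {x})) hs
  haveI : Module.Finite R N := Module.Finite.trans (R ⧸ Ideal.span {x}) N
  obtain ⟨p, hp⟩ := h (ModuleCat.of R N) this ⟨n + 1, fun i hi => by
    obtain ⟨j, rfl⟩ : ∃ j, i = j + 1 := ⟨i - 1, by omega⟩
    exact transfer e x hregM hregR hs hk j N (hn (j+1) (by omega))⟩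
  have hp' : HasProjectiveDimensionLT (ModuleCat.of R N) (p + 1) := (projDimLE_iff R _ p).1 hp
  obtain ⟨m, hm⟩ := descent x hx hx2 hregR hs hk p N
    (hasProjectiveDimensionLT_of_ge _ (p+1) (p+2) (by omega))
  exact ⟨m, (projDimLE_iff _ _ m).2 (hasProjectiveDimensionLT_of_ge _ m (m+1) (by omega))⟩
end

section
/- Let R → S be a finite local homomorphism of commutative Noetherian local rings and let M be a test module over S. Assume that every finitely generated R-module X with Tor_i^R(S,X)=0 for all i >> 0 satisfies Tor_i^R(M,X)=0 for all i >> 0. Then S is a test module over R. -/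
open CategoryTheory IsLocalRing

universe v u v' u'

section Generic
open CategoryTheory CategoryTheory.Limits

variable {C : Type u} [Category.{v} C] [Abelian C]
  {D : Type u'} [Category.{v'} D] [Abelian D]

/-- the augmentation of a projective resolution -/
noncomputable def resEps {X : C} (Q : ProjectiveResolution X) : Q.complex.X 0 ⟶ X := Q.π.f 0

lemma resEps_comp {X : C} (Q : ProjectiveResolution X) : Q.complex.d 1 0 ≫ resEps Q = 0 :=
  Q.complex_d_comp_π_f_zero

instance resEps_epi {X : C} (Q : ProjectiveResolution X) : Epi (resEps Q) :=
  inferInstanceAs (Epi (Q.π.f 0))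

lemma resEps_exact {X : C} (Q : ProjectiveResolution X) :
    (ShortComplex.mk _ _ (resEps_comp Q)).Exact :=
  ShortComplex.exact_of_g_is_cokernel _ Q.isColimitCokernelCofork

/-- In an abelian category, if `f ≫ e = 0` is exact with `e` epi, then `f, e ≫ m` is exact iff
`m` is mono. -/
lemma exact_comp_iff_mono {A B K E : C} (f : A ⟶ B) (e : B ⟶ K) (m : K ⟶ E) (w : f ≫ e = 0)
    (w' : f ≫ e ≫ m = 0) (h : (ShortComplex.mk f e w).Exact) [Epi e] :
    (ShortComplex.mk f (e ≫ m) w').Exact ↔ Mono m := by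
  constructor
  · intro hex
    refine Preadditive.mono_of_cancel_zero _ fun {T} x hx => ?_
    obtain ⟨A', p, hp, y, hy⟩ := surjective_up_to_refinements_of_epi e x
    obtain ⟨A'', q, hq, z, hz⟩ := hex.exact_up_to_refinements y (by
      change y ≫ e ≫ m = 0
      rw [← Category.assoc, ← hy, Category.assoc, hx, comp_zero])
    rw [← cancel_epi p, ← cancel_epi q, hy, ← Category.assoc, hz]
    simp [w]
  · intro hm
    let φ : ShortComplex.mk f e w ⟶ ShortComplex.mk f (e ≫ m) w' :=
      { τ₁ := 𝟙 _, τ₂ := 𝟙 _, τ₃ := m }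
    have : Epi φ.τ₁ := inferInstanceAs (Epi (𝟙 _))
    have : IsIso φ.τ₂ := inferInstanceAs (IsIso (𝟙 _))
    have : Mono φ.τ₃ := hm
    exact (ShortComplex.exact_iff_of_epi_of_isIso_of_mono φ).1 h

lemma splice_w {S : ShortComplex C} 
    (Q : ProjectiveResolution S.X₁) : Q.complex.d 1 0 ≫ resEps Q ≫ S.f = 0 := by
  rw [← Category.assoc, resEps_comp, zero_comp]

/-- spliced complex -/
noncomputable abbrev spliceCx {S : ShortComplex C}
    (Q : ProjectiveResolution S.X₁) : ChainComplex C ℕ :=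
  ChainComplex.augment Q.complex (resEps Q ≫ S.f) (splice_w Q)

lemma splice_exact {S : ShortComplex C} (hS : S.ShortExact)
    (Q : ProjectiveResolution S.X₁) (n : ℕ) : (spliceCx Q).ExactAt (n + 1) := by
  rw [HomologicalComplex.exactAt_iff' _ (n + 1 + 1) (n + 1) n (by simp) (by simp)]
  cases n with
  | zero => 
    have := hS.mono_f
    exact (exact_comp_iff_mono _ _ S.f (resEps_comp Q) (splice_w Q) (resEps_exact Q)).2 this
  | succ n => exact Q.exact_succ n

lemma splice_w' {S : ShortComplex C}
    (Q : ProjectiveResolution S.X₁) : (spliceCx Q).d 1 0 ≫ S.g = 0 := by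
  change (resEps Q ≫ S.f) ≫ S.g = 0
  simp

lemma splice_exact₀ {S : ShortComplex C} (hS : S.ShortExact)
    (Q : ProjectiveResolution S.X₁) : (ShortComplex.mk _ _ (splice_w' Q)).Exact := by
  let φ : ShortComplex.mk _ _ (splice_w' Q) ⟶ S :=
    { τ₁ := resEps Q, τ₂ := 𝟙 S.X₂, τ₃ := 𝟙 S.X₃
      comm₁₂ := (Category.comp_id (resEps Q ≫ S.f)).symm
      comm₂₃ := (Category.id_comp S.g).trans (Category.comp_id S.g).symm }
  have : Epi φ.τ₁ := resEps_epi Q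
  have : IsIso φ.τ₂ := inferInstanceAs (IsIso (𝟙 _))
  have : Mono φ.τ₃ := inferInstanceAs (Mono (𝟙 _))
  exact (ShortComplex.exact_iff_of_epi_of_isIso_of_mono φ).2 hS.exact

lemma splice_aux {S : ShortComplex C} (hS : S.ShortExact)
    (Q : ProjectiveResolution S.X₁) (g : S.X₂ ⟶ S.X₃) (e : g = S.g)
    (w : (spliceCx Q).d 1 0 ≫ g = 0) : (ShortComplex.mk _ g w).Exact ∧ Epi g := by
  subst e
  exact ⟨splice_exact₀ hS Q, hS.epi_g⟩

/-- splice a projective resolution of the kernel. -/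
noncomputable def spliceRes {S : ShortComplex C} (hS : S.ShortExact) [Projective S.X₂]
    (Q : ProjectiveResolution S.X₁) : ProjectiveResolution S.X₃ where
  complex := spliceCx Q
  projective n := by
    cases n with
    | zero => exact inferInstanceAs (Projective S.X₂)
    | succ n => exact inferInstanceAs (Projective (Q.complex.X n))
  π := (ChainComplex.toSingle₀Equiv _ _).symm ⟨S.g, splice_w' Q⟩
  quasiIso := ⟨fun n => by
    cases n
    · rw [ChainComplex.quasiIsoAt₀_iff, ShortComplex.quasiIso_iff_of_zeros']
      · have e : ((ChainComplex.toSingle₀Equiv (spliceCx Q) S.X₃).symm ⟨S.g, splice_w' Q⟩).f 0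
            = S.g := ChainComplex.toSingle₀Equiv_symm_apply_f_zero _ _
        exact splice_aux hS Q _ e _
      all_goals rfl
    · rw [quasiIsoAt_iff_exactAt']
      · exact splice_exact hS Q _
      · apply ChainComplex.exactAt_succ_single_obj⟩

variable [HasProjectiveResolutions C] (G : C ⥤ D) [G.Additive]

lemma isZero_leftDerived_iff {X : C} (P : ProjectiveResolution X) (n : ℕ) :
    IsZero ((G.leftDerived (n + 1)).obj X) ↔
      (ShortComplex.mk (G.map (P.complex.d (n + 2) (n + 1))) (G.map (P.complex.d (n + 1) n))
        (by rw [← G.map_comp]; simp)).Exact := by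
  rw [(P.isoLeftDerivedObj G (n + 1)).isZero_iff]
  refine (HomologicalComplex.exactAt_iff_isZero_homology _ _).symm.trans ?_
  rw [HomologicalComplex.exactAt_iff' _ (n + 2) (n + 1) n (by simp) (by simp)]
  rfl

lemma leftDerived_succ_iff {S : ShortComplex C} (hS : S.ShortExact) [Projective S.X₂] (n : ℕ) :
    IsZero ((G.leftDerived (n + 2)).obj S.X₃) ↔ IsZero ((G.leftDerived (n + 1)).obj S.X₁) := by
  let Q := (HasProjectiveResolution.out (Z := S.X₁)).some
  rw [isZero_leftDerived_iff G Q, isZero_leftDerived_iff G (spliceRes hS Q)]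
  rfl

lemma leftDerived_one_iff [PreservesFiniteColimits G] {S : ShortComplex C} (hS : S.ShortExact)
    [Projective S.X₂] :
    IsZero ((G.leftDerived 1).obj S.X₃) ↔ Mono (G.map S.f) := by
  let Q := (HasProjectiveResolution.out (Z := S.X₁)).some
  rw [isZero_leftDerived_iff G (spliceRes hS Q)]
  have hh := (Functor.preservesFiniteColimits_tfae G).out 3 1
  obtain ⟨h2, h3⟩ := hh.1 inferInstance (ShortComplex.mk _ _ (resEps_comp Q))
    ⟨resEps_exact Q, resEps_epi Q⟩
  have h3' : Epi (G.map (resEps Q)) := h3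
  have w1 : G.map (Q.complex.d 1 0) ≫ G.map (resEps Q) = 0 := by
    rw [← G.map_comp, resEps_comp, G.map_zero]
  have w2 : G.map (Q.complex.d 1 0) ≫ G.map (resEps Q) ≫ G.map S.f = 0 := by
    rw [← Category.assoc, w1, zero_comp]
  rw [← exact_comp_iff_mono (G.map (Q.complex.d 1 0)) (G.map (resEps Q)) (G.map S.f) w1 w2 h2]
  have w3 : G.map (Q.complex.d 1 0) ≫ G.map (resEps Q ≫ S.f) = 0 := by
    rw [G.map_comp, w2]
  change (ShortComplex.mk (G.map (Q.complex.d 1 0)) (G.map (resEps Q ≫ S.f)) w3).Exact ↔ _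
  simp only [G.map_comp]

end Generic

section Mod
open CategoryTheory CategoryTheory.Limits TensorProduct

variable {R : Type} [CommRing R] {K F X : Type} [AddCommGroup K] [AddCommGroup F] [AddCommGroup X]
  [Module R K] [Module R F] [Module R X]

/-- the short complex of modules -/
abbrev scOf (f : K →ₗ[R] F) (g : F →ₗ[R] X) (h : Function.Exact f g) :
    ShortComplex (ModuleCat.{0} R) :=
  ShortComplex.mk (ModuleCat.ofHom f) (ModuleCat.ofHom g)
    (by ext x; exact h.apply_apply_eq_zero x)

lemma scOf_shortExact (f : K →ₗ[R] F) (g : F →ₗ[R] X) (h : Function.Exact f g)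
    (hf : Function.Injective f) (hg : Function.Surjective g) : (scOf f g h).ShortExact where
  exact := (ShortComplex.ShortExact.moduleCat_exact_iff_function_exact _).2 h
  mono_f := (ModuleCat.mono_iff_injective _).2 hf
  epi_g := (ModuleCat.epi_iff_surjective _).2 hg

lemma tor_succ_iff (M : ModuleCat.{0} R) (f : K →ₗ[R] F) (g : F →ₗ[R] X) (h : Function.Exact f g)
    (hf : Function.Injective f) (hg : Function.Surjective g) [Module.Projective R F] (n : ℕ) :
    Subsingleton (TorM R (n + 2) M (ModuleCat.of R X)) ↔
      Subsingleton (TorM R (n + 1) M (ModuleCat.of R K)) := by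
  have : Projective (scOf f g h).X₂ := (IsProjective.iff_projective _).1 ‹_›
  have := leftDerived_succ_iff ((MonoidalCategory.tensoringLeft _).obj M)
    (scOf_shortExact f g h hf hg) n
  rw [ModuleCat.isZero_iff_subsingleton, ModuleCat.isZero_iff_subsingleton] at this
  exact this

lemma tor_one_iff (M : ModuleCat.{0} R) (f : K →ₗ[R] F) (g : F →ₗ[R] X) (h : Function.Exact f g)
    (hf : Function.Injective f) (hg : Function.Surjective g) [Module.Projective R F] :
    Subsingleton (TorM R 1 M (ModuleCat.of R X)) ↔ Function.Injective (f.lTensor M) := by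
  have : Projective (scOf f g h).X₂ := (IsProjective.iff_projective _).1 ‹_›
  have : PreservesFiniteColimits ((MonoidalCategory.tensoringLeft (ModuleCat.{0} R)).obj M) :=
    inferInstanceAs (PreservesFiniteColimits (MonoidalCategory.tensorLeft M))
  have := leftDerived_one_iff ((MonoidalCategory.tensoringLeft _).obj M)
    (scOf_shortExact f g h hf hg)
  rw [ModuleCat.isZero_iff_subsingleton, ModuleCat.mono_iff_injective] at this
  exact this

lemma isZero_op_iff {C : Type*} [Category C] [HasZeroMorphisms C] (X : Cᵒᵖ) :
    IsZero X ↔ IsZero X.unop := ⟨fun h => h.unop, fun h => h.op⟩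

lemma ext_succ_iff (L : ModuleCat.{0} R) (f : K →ₗ[R] F) (g : F →ₗ[R] X) (h : Function.Exact f g)
    (hf : Function.Injective f) (hg : Function.Surjective g) [Module.Projective R F] (n : ℕ) :
    Subsingleton (ExtM R (n + 2) (ModuleCat.of R X) L) ↔
      Subsingleton (ExtM R (n + 1) (ModuleCat.of R K) L) := by
  have : Projective (scOf f g h).X₂ := (IsProjective.iff_projective _).1 ‹_›
  have := leftDerived_succ_iff ((linearYoneda R (ModuleCat R)).obj L).rightOp
    (scOf_shortExact f g h hf hg) n
  rw [isZero_op_iff, isZero_op_iff, ModuleCat.isZero_iff_subsingleton, 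
    ModuleCat.isZero_iff_subsingleton] at this
  exact this

lemma ext_one_iff (L : ModuleCat.{0} R) (f : K →ₗ[R] F) (g : F →ₗ[R] X) (h : Function.Exact f g)
    (hf : Function.Injective f) (hg : Function.Surjective g) [Module.Projective R F] :
    Subsingleton (ExtM R 1 (ModuleCat.of R X) L) ↔
      ∀ φ : K →ₗ[R] L, ∃ ψ : F →ₗ[R] L, ψ ∘ₗ f = φ := by
  have : Projective (scOf f g h).X₂ := (IsProjective.iff_projective _).1 ‹_›
  have : PreservesFiniteLimits (((linearYoneda R (ModuleCat.{0} R)).obj L) ⋙ forget _) :=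
    inferInstanceAs (PreservesFiniteLimits (yoneda.obj L))
  have : PreservesFiniteLimits ((linearYoneda R (ModuleCat.{0} R)).obj L) :=
    preservesFiniteLimits_of_reflects_of_preserves _ (forget _)
  have := preservesFiniteColimits_rightOp ((linearYoneda R (ModuleCat.{0} R)).obj L)
  have := leftDerived_one_iff ((linearYoneda R (ModuleCat.{0} R)).obj L).rightOp
    (scOf_shortExact f g h hf hg)
  rw [isZero_op_iff, ModuleCat.isZero_iff_subsingleton] at this
  refine this.trans ?_
  have e : Mono (((linearYoneda R (ModuleCat.{0} R)).obj L).rightOp.map (ModuleCat.ofHom f)) ↔ 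
    Epi (((linearYoneda R (ModuleCat.{0} R)).obj L).map (ModuleCat.ofHom f).op) := 
     ⟨fun _ => inferInstanceAs (Epi
        ((((linearYoneda R (ModuleCat.{0} R)).obj L).rightOp.map (ModuleCat.ofHom f)).unop)),
      fun h => @op_mono_of_epi _ _ _ _ _ h⟩
  refine e.trans ?_
  rw [ModuleCat.epi_iff_surjective]
  constructor
  · intro h φ
    obtain ⟨ψ, hψ⟩ := h (ModuleCat.ofHom φ)
    exact ⟨ψ.hom, congrArg ModuleCat.Hom.hom hψ⟩
  · intro h φ
    obtain ⟨ψ, hψ⟩ := h φ.hom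
    exact ⟨ModuleCat.ofHom ψ, ModuleCat.hom_ext hψ⟩

end Mod

section Alg
open TensorProduct

variable {R : Type} [CommRing R]

lemma lTensor_inj_iff_baseChange {A : Type} [CommRing A] [Algebra R A]
    {N K F : Type} [AddCommGroup N] [Module A N] [Module R N] [IsScalarTower R A N]
    [AddCommGroup K] [Module R K] [AddCommGroup F] [Module R F] (f : K →ₗ[R] F) :
    Function.Injective (f.lTensor N) ↔ Function.Injective ((f.baseChange A).lTensor N) := by
  let eK := AlgebraTensorModule.cancelBaseChange R A A N K
  let eF := AlgebraTensorModule.cancelBaseChange R A A N F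
  have key : ∀ z, eF ((f.baseChange A).lTensor N z) = f.lTensor N (eK z) := by
    intro z
    induction z with
    | zero => simp
    | add x y hx hy => simp only [map_add, hx, hy]
    | tmul n w =>
      induction w with
      | zero => simp
      | add x y hx hy => simp only [tmul_add, map_add, hx, hy]
      | tmul a x => simp [eK, eF]
  have e : (f.lTensor N : N ⊗[R] K → N ⊗[R] F) ∘ eK = eF ∘ ((f.baseChange A).lTensor N) := by
    funext z; exact (key z).symm
  rw [← Function.Injective.of_comp_iff eF.injective, ← e]
  exact (Function.Injective.of_comp_iff' _ eK.bijective).symm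

lemma exists_pres [IsNoetherianRing R] (X : Type) [AddCommGroup X] [Module R X]
    [Module.Finite R X] : ∃ (n : ℕ) (g : (Fin n → R) →ₗ[R] X), Function.Surjective g :=
  Module.Finite.exists_fin' R X

lemma exists_proj_pres (X : Type) [AddCommGroup X] [Module R X] :
    ∃ (F : Type) (_ : AddCommGroup F) (_ : Module R F) (_ : Module.Projective R F)
      (g : F →ₗ[R] X), Function.Surjective g :=
  ⟨X →₀ R, inferInstance, inferInstance, inferInstance, _,
    Finsupp.linearCombination_id_surjective R X⟩

lemma exact_baseChange {K F X : Type} [AddCommGroup K] [AddCommGroup F] [AddCommGroup X]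
    [Module R K] [Module R F] [Module R X] (S : Type) [CommRing S] [Algebra R S]
    (f : K →ₗ[R] F) (g : F →ₗ[R] X) (h : Function.Exact f g) (hg : Function.Surjective g) :
    Function.Exact (f.baseChange S) (g.baseChange S) ∧ Function.Surjective (g.baseChange S) :=
  ⟨lTensor_exact S h hg, LinearMap.lTensor_surjective S hg⟩

/-- All positive `Tor` vanish. -/
def TorPosZero (R : Type) [CommRing R] (M X : ModuleCat.{0} R) : Prop :=
  ∀ i : ℕ, Subsingleton (TorM R (i + 1) M X)

lemma tor_compare (S : Type) [CommRing S] [Algebra R S] (M : Type) [AddCommGroup M] [Module S M]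
    [Module R M] [IsScalarTower R S M] (n : ℕ) :
    ∀ (X : Type) [AddCommGroup X] [Module R X],
      TorPosZero R (ModuleCat.of R S) (ModuleCat.of R X) →
      (Subsingleton (TorM R (n + 1) (ModuleCat.of R M) (ModuleCat.of R X)) ↔
        Subsingleton (TorM S (n + 1) (ModuleCat.of S M) (ModuleCat.of S (S ⊗[R] X)))) := by
  induction n with
  | zero =>
    intro X _ _ hX
    obtain ⟨F, _, _, _, g, hg⟩ := exists_proj_pres (R := R) X
    let f := (LinearMap.ker g).subtype
    have hf : Function.Injective f := Subtype.val_injective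
    have h : Function.Exact f g := LinearMap.exact_subtype_ker_map g
    have hS : Function.Injective (f.baseChange S) := (tor_one_iff _ f g h hf hg).1 (hX 0)
    obtain ⟨h', hg'⟩ := exact_baseChange S f g h hg
    rw [tor_one_iff _ f g h hf hg, tor_one_iff _ _ _ h' hS hg']
    exact lTensor_inj_iff_baseChange f
  | succ n ih =>
    intro X _ _ hX
    obtain ⟨F, _, _, _, g, hg⟩ := exists_proj_pres (R := R) X
    let f := (LinearMap.ker g).subtype
    have hf : Function.Injective f := Subtype.val_injective
    have h : Function.Exact f g := LinearMap.exact_subtype_ker_map g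
    have hS : Function.Injective (f.baseChange S) := (tor_one_iff _ f g h hf hg).1 (hX 0)
    obtain ⟨h', hg'⟩ := exact_baseChange S f g h hg
    rw [tor_succ_iff _ f g h hf hg, tor_succ_iff _ _ _ h' hS hg']
    exact ih _ fun i => (tor_succ_iff _ f g h hf hg i).1 (hX (i + 1))

lemma finProjDim_of_projective (X : Type) [AddCommGroup X] [Module R X] [Module.Projective R X] :
    FinProjDim R (ModuleCat.of R X) := by
  refine ⟨0, fun i hi L => ?_⟩
  obtain ⟨i, rfl⟩ : ∃ j, i = j + 1 := ⟨i - 1, by omega⟩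
  have : Projective (ModuleCat.of R X) := (IsProjective.iff_projective _).1 ‹_›
  exact ModuleCat.isZero_iff_subsingleton.1 (isZero_Ext_succ_of_projective _ L i)

lemma finProjDim_of_syz {K F X : Type} [AddCommGroup K] [AddCommGroup F] [AddCommGroup X]
    [Module R K] [Module R F] [Module R X] 
    (f : K →ₗ[R] F) (g : F →ₗ[R] X) (h : Function.Exact f g)
    (hf : Function.Injective f) (hg : Function.Surjective g) [Module.Projective R F]
    (hK : FinProjDim R (ModuleCat.of R K)) : FinProjDim R (ModuleCat.of R X) := by
  obtain ⟨n, hn⟩ := hK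
  refine ⟨n + 1, fun i hi L => ?_⟩
  obtain ⟨i, rfl⟩ : ∃ j, i = j + 2 := ⟨i - 2, by omega⟩
  exact (ext_succ_iff L f g h hf hg i).2 (hn _ (by omega) L)

lemma pd_descend [IsLocalRing R] [IsNoetherianRing R] (S : Type) [CommRing S] [IsLocalRing S]
    [Algebra R S] [IsLocalHom (algebraMap R S)] (n : ℕ) :
    ∀ (X : Type) [AddCommGroup X] [Module R X] [Module.Finite R X],
      TorPosZero R (ModuleCat.of R S) (ModuleCat.of R X) →
      ProjDimLE S (ModuleCat.of S (S ⊗[R] X)) n → FinProjDim R (ModuleCat.of R X) := by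
  induction n with
  | zero =>
    intro X _ _ _ hX hpd
    obtain ⟨m, g, hg⟩ := exists_pres (R := R) X
    let f := (LinearMap.ker g).subtype
    have hf : Function.Injective f := Subtype.val_injective
    have h : Function.Exact f g := LinearMap.exact_subtype_ker_map g
    have hS : Function.Injective (f.baseChange S) := (tor_one_iff _ f g h hf hg).1 (hX 0)
    obtain ⟨h', hg'⟩ := exact_baseChange S f g h hg
    obtain ⟨r, hr⟩ := (ext_one_iff (ModuleCat.of S (S ⊗[R] LinearMap.ker g)) _ _ h' hS hg').1
      (hpd 1 (by omega) _) LinearMap.id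
    have h1 : Function.Injective ((f.baseChange S).lTensor (ResidueField S)) := by
      apply Function.LeftInverse.injective (g := r.lTensor (ResidueField S))
      intro z
      rw [← LinearMap.comp_apply, ← LinearMap.lTensor_comp, hr, LinearMap.lTensor_id]
      rfl
    have h2 := (lTensor_inj_iff_baseChange f).2 h1
    have h3 := (lTensor_inj_iff_baseChange (A := ResidueField R) f).1 h2
    have h4 := (Module.FaithfullyFlat.lTensor_injective_iff_injective _ _ _).1 h3
    have : Module.Free R X := Module.free_of_lTensor_residueField_injective (f := f) (g := g) hg h h4
    exact finProjDim_of_projective X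
  | succ n ih =>
    intro X _ _ _ hX hpd
    obtain ⟨m, g, hg⟩ := exists_pres (R := R) X
    let f := (LinearMap.ker g).subtype
    have hf : Function.Injective f := Subtype.val_injective
    have h : Function.Exact f g := LinearMap.exact_subtype_ker_map g
    have hS : Function.Injective (f.baseChange S) := (tor_one_iff _ f g h hf hg).1 (hX 0)
    obtain ⟨h', hg'⟩ := exact_baseChange S f g h hg
    refine finProjDim_of_syz f g h hf hg (ih _ ?_ ?_)
    · exact fun i => (tor_succ_iff _ f g h hf hg i).1 (hX (i + 1))
    · intro i hi L
      obtain ⟨i, rfl⟩ : ∃ j, i = j + 1 := ⟨i - 1, by omega⟩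
      exact (ext_succ_iff L _ _ h' hS hg' i).1 (hpd _ (by omega) L)

lemma main_aux [IsLocalRing R] [IsNoetherianRing R] (S : Type) [CommRing S] [IsLocalRing S]
    [Algebra R S] [IsLocalHom (algebraMap R S)]
    (M : Type) [AddCommGroup M] [Module S M] [Module R M] [IsScalarTower R S M]
    (hM : IsTestModule S (ModuleCat.of S M)) (n : ℕ) :
    ∀ (X : Type) [AddCommGroup X] [Module R X] [Module.Finite R X],
      (∀ i, n ≤ i → Subsingleton (TorM R (i + 1) (ModuleCat.of R S) (ModuleCat.of R X))) →
      TorEventuallyZero R (ModuleCat.of R M) (ModuleCat.of R X) →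
      FinProjDim R (ModuleCat.of R X) := by
  induction n with
  | zero =>
    intro X _ _ _ hX hMX
    have hX' : TorPosZero R (ModuleCat.of R S) (ModuleCat.of R X) := fun i => hX i (by omega)
    obtain ⟨n, hn⟩ := hM (ModuleCat.of S (S ⊗[R] X))
      (inferInstanceAs (Module.Finite S (S ⊗[R] X))) (by
        obtain ⟨n, hn⟩ := hMX
        refine ⟨n + 1, fun i hi => ?_⟩
        obtain ⟨i, rfl⟩ : ∃ j, i = j + 1 := ⟨i - 1, by omega⟩
        exact (tor_compare S M i X hX').1 (hn _ (by omega)))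
    exact pd_descend S n X hX' hn
  | succ n ih =>
    intro X _ _ _ hX hMX
    obtain ⟨m, g, hg⟩ := exists_pres (R := R) X
    let f := (LinearMap.ker g).subtype
    have hf : Function.Injective f := Subtype.val_injective
    have h : Function.Exact f g := LinearMap.exact_subtype_ker_map g
    refine finProjDim_of_syz f g h hf hg (ih _ ?_ ?_)
    · exact fun i hi => (tor_succ_iff _ f g h hf hg i).1 (hX (i + 1) (by omega))
    · obtain ⟨n, hn⟩ := hMX
      refine ⟨n + 1, fun i hi => ?_⟩
      obtain ⟨i, rfl⟩ : ∃ j, i = j + 1 := ⟨i - 1, by omega⟩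
      exact (tor_succ_iff _ f g h hf hg i).1 (hn _ (by omega))

end Alg

/-- Let `R → S` be a finite local homomorphism and `M` a test module over `S`.
If every finitely generated `R`-module `X` with `Tor_i^R(S,X) = 0` for `i ≫ 0`
satisfies `Tor_i^R(M,X) = 0` for `i ≫ 0`, then `S` is a test module over `R`. -/
theorem testModule_of_finite_extension
    (R S : Type) [CommRing R] [CommRing S] [IsLocalRing R] [IsLocalRing S]
    [IsNoetherianRing R] [IsNoetherianRing S] [Algebra R S]
    [Module.Finite R S] [IsLocalHom (algebraMap R S)]
    (M : Type) [AddCommGroup M] [Module S M] [Module.Finite S M]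
    [Module R M] [IsScalarTower R S M]
    (hM : IsTestModule S (ModuleCat.of S M))
    (hyp : ∀ X : ModuleCat R, Module.Finite R X →
      TorEventuallyZero R (ModuleCat.of R S) X →
      TorEventuallyZero R (ModuleCat.of R M) X) :
    IsTestModule R (ModuleCat.of R S) := by
  intro X hX hT
  have hMX := hyp X hX hT
  obtain ⟨n, hn⟩ := hT
  exact main_aux (R := R) S M hM n X (fun i hi => hn (i + 1) (by omega)) hMX
end
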